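/- arXiv:1810.05280 — 5 statements merged into one kernel-verified Lean document; each statement's English description precedes it below -/
import Mathlib

section
/- Let G be a finite simple graph and C a cycle of G of length at least 4. Suppose a section Q of C forms an induced path of G and Q contains a subpath P of length at least 2 none of whose internal vertices is incident to a chord of C in G. Then P can be extended to a hole H of G such that V(P) ⊊ V(H) ⊆ V(C) and H contains a vertex of C that is not on Q. -/
open SimpleGraph

variable {V : Type*}

/-- A *hole* of `G`: an induced cycle of length at least 4, given as a closed walk. -/
def IsHole (G : SimpleGraph V) {a : V} (w : G.Walk a a) : Prop :=
  w.IsCycle ∧ 4 ≤ w.length ∧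
    ∀ x y : V, x ∈ w.support → y ∈ w.support → G.Adj x y → s(x, y) ∈ w.edges

/-- A graph is *chordal* if it has no hole. -/
def IsChordal (G : SimpleGraph V) : Prop :=
  ∀ (a : V) (w : G.Walk a a), ¬ IsHole G w

/-- Two edge lists share two consecutive edges. -/
def ShareTwoConsecutiveEdges (l₁ l₂ : List (Sym2 V)) : Prop :=
  ∃ x y z : V, x ≠ z ∧ s(x, y) ∈ l₁ ∧ s(y, z) ∈ l₁ ∧ s(x, y) ∈ l₂ ∧ s(y, z) ∈ l₂

/-- A vertex `u` satisfies the *NC property* in `G`: no hole through `u` and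
no hole avoiding `u` share two consecutive edges. -/
def VertexNC (G : SimpleGraph V) (u : V) : Prop :=
  ∀ (a b : V) (w₁ : G.Walk a a) (w₂ : G.Walk b b),
    IsHole G w₁ → IsHole G w₂ → u ∈ w₁.support → u ∉ w₂.support →
      ¬ ShareTwoConsecutiveEdges w₁.edges w₂.edges

/-- A *hole cover* of `G`: a nonempty vertex set meeting every hole of `G`. -/
def IsHoleCover (G : SimpleGraph V) (C : Set V) : Prop :=
  C.Nonempty ∧ ∀ (a : V) (w : G.Walk a a), IsHole G w → ∃ u ∈ C, u ∈ w.support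

/-- A vertex set `C` satisfies the *NC property* in `G`: every vertex of `C`
satisfies the NC property and every hole of `G` contains at most one vertex of `C`. -/
def SetNC (G : SimpleGraph V) (C : Set V) : Prop :=
  (∀ u ∈ C, VertexNC G u) ∧
    ∀ (a : V) (w : G.Walk a a), IsHole G w →
      ∀ u ∈ C, ∀ v ∈ C, u ∈ w.support → v ∈ w.support → u = v

/-- A graph satisfies the *NC property* if it has a hole cover satisfying the NC property. -/
def HasNCProperty (G : SimpleGraph V) : Prop :=
  ∃ C : Set V, IsHoleCover G C ∧ SetNC G C

/-- A DP-cover of `G` with lists of size `k`, realized on the vertex set `V × Fin k`: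
the fibers `{v} × Fin k` are cliques, cross edges exist only over edges of `G`,
and the edges between two fibers form a matching. -/
def IsDPCover (G : SimpleGraph V) (k : ℕ) (H : SimpleGraph (V × Fin k)) : Prop :=
  (∀ (v : V) (i j : Fin k), i ≠ j → H.Adj (v, i) (v, j)) ∧
  (∀ (u v : V) (i j : Fin k), u ≠ v → H.Adj (u, i) (v, j) → G.Adj u v) ∧
  (∀ (u v : V) (i j j' : Fin k), u ≠ v → H.Adj (u, i) (v, j) → H.Adj (u, i) (v, j') → j = j')

/-- `G` is DP-`k`-colorable: every DP-cover with lists of size `k` admits an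
independent transversal. -/
def DPColorable (G : SimpleGraph V) (k : ℕ) : Prop :=
  ∀ H : SimpleGraph (V × Fin k), IsDPCover G k H →
    ∃ f : V → Fin k, ∀ u v : V, ¬ H.Adj (u, f u) (v, f v)

/-- The DP-chromatic number: the least `k` such that `G` is DP-`k`-colorable. -/
noncomputable def dpChromaticNumber (G : SimpleGraph V) : ℕ :=
  sInf {k | DPColorable G k}

/-- `M` is a minor of `G`, via the branch-set characterization. -/
def HasMinor {W : Type*} (G : SimpleGraph V) (M : SimpleGraph W) : Prop :=
  ∃ B : W → Set V,
    (∀ i, (B i).Nonempty) ∧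
    (∀ i, (G.induce (B i)).Connected) ∧
    (Pairwise fun i j => Disjoint (B i) (B j)) ∧
    ∀ i j, M.Adj i j → ∃ a ∈ B i, ∃ b ∈ B j, G.Adj a b

/-- Locally chordalize by `u` all holes of `G` containing `u`: add all edges
joining `u` to the vertices of such holes (new edges go to the vertices
nonadjacent to `u`). -/
def localChordalize (G : SimpleGraph V) (u : V) : SimpleGraph V :=
  G ⊔ SimpleGraph.fromRel fun x y =>
    x = u ∧ ∃ (a : V) (w : G.Walk a a), IsHole G w ∧ u ∈ w.support ∧ y ∈ w.support

/-- Recursive local chordalizations along a list of vertices. -/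
def chordalizeList (G : SimpleGraph V) : List V → SimpleGraph V
  | [] => G
  | u :: l => chordalizeList (localChordalize G u) l

/-- Delete a vertex set (keeping the ambient vertex type: the removed vertices
become isolated). -/
def removeVerts (G : SimpleGraph V) (A : Set V) : SimpleGraph V where
  Adj x y := G.Adj x y ∧ x ∉ A ∧ y ∉ A
  symm := ⟨by intro x y h; exact ⟨h.1.symm, h.2.2, h.2.1⟩⟩
  loopless := ⟨by intro x h; exact G.loopless.irrefl x h.1⟩

/-- The chordalization chain corresponding to an ordered partition
`parts 0, …, parts (k-1)` (playing the role of `C₁, …, C_k`) of a hole cover: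
`(lcChain G parts i).1 = Gᵢ` and `(lcChain G parts i).2 = Gᵢ*`. -/
def lcChain (G : SimpleGraph V) {k : ℕ} (parts : Fin k → List V) :
    ℕ → SimpleGraph V × SimpleGraph V
  | 0 =>
      (removeVerts G {v | ∃ i, v ∈ parts i}, removeVerts G {v | ∃ i, v ∈ parts i})
  | i + 1 =>
      let Gi := (lcChain G parts i).2 ⊔
        removeVerts G {v | ∃ j : Fin k, i + 1 ≤ (j : ℕ) ∧ v ∈ parts j}
      (Gi, if h : i < k then chordalizeList Gi (parts ⟨i, h⟩) else Gi)

/-- `(parts 0, …, parts (k-1))` is a *local chordalization partition* of the hole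
cover `C` of `G`. -/
def IsLCPartition (G : SimpleGraph V) (C : Set V) {k : ℕ} (parts : Fin k → List V) : Prop :=
  (∀ i, (parts i).Nodup) ∧
  (∀ i, parts i ≠ []) ∧
  (Pairwise fun i j : Fin k => ∀ v, v ∈ parts i → v ∉ parts j) ∧
  {v | ∃ i, v ∈ parts i} = C ∧
  ∀ i : Fin k,
    IsHoleCover (lcChain G parts ((i : ℕ) + 1)).1 {v | v ∈ parts i} ∧
    SetNC (lcChain G parts ((i : ℕ) + 1)).1 {v | v ∈ parts i} ∧
    IsChordal (lcChain G parts ((i : ℕ) + 1)).2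

/-- The *non-chordality index* of `G`. -/
noncomputable def ncIndex (G : SimpleGraph V) : ℕ := by
  classical exact
    if IsChordal G then 0
    else sInf {k | ∃ (C : Set V) (parts : Fin k → List V),
      IsHoleCover G C ∧ IsLCPartition G C parts}

/-- `G` is `k`-list-colorable. -/
def ListColorable (G : SimpleGraph V) (k : ℕ) : Prop :=
  ∀ L : V → Finset ℕ, (∀ v, k ≤ (L v).card) →
    ∃ f : V → ℕ, (∀ v, f v ∈ L v) ∧ ∀ u v : V, G.Adj u v → f u ≠ f v

/-- The list chromatic number of `G`. -/
noncomputable def listChromaticNumber (G : SimpleGraph V) : ℕ :=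
  sInf {k | ListColorable G k}

theorem aux_path_no_cycle {V : Type*} {G : SimpleGraph V} {a b r : V} (Q : G.Walk a b)
    (hQ : Q.IsPath) (w : G.Walk r r) (hw : w.IsCycle) (hsub : ∀ e ∈ w.edges, e ∈ Q.edges) :
    False := by
  induction Q with
  | nil =>
    have h3 := hw.three_le_length
    rw [← Walk.length_edges] at h3
    cases hE : w.edges with
    | nil => simp [hE] at h3
    | cons e l => have := hsub e (by simp [hE]); simp at this
  | @cons u v z h Q ih =>
    rw [Walk.cons_isPath_iff] at hQ
    by_cases hu : u ∈ w.support
    · have h2 := hw.ncard_neighborSet_toSubgraph_eq_two hu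
      have hs : w.toSubgraph.neighborSet u ⊆ {v} := by
        intro y hy
        have hy' : s(u, y) ∈ w.edges := Walk.adj_toSubgraph_iff_mem_edges.mp hy
        have := hsub _ hy'
        rw [Walk.edges_cons, List.mem_cons] at this
        rcases this with h1 | h1
        · have := Sym2.congr_right.mp h1
          simpa using this
        · exact absurd (Q.fst_mem_support_of_mem_edges h1) hQ.2
      have := Set.ncard_le_ncard hs
      rw [h2] at this
      simp at this
    · apply ih hQ.1
      intro e he
      have := hsub e he
      rw [Walk.edges_cons, List.mem_cons] at this
      rcases this with h1 | h1
      · subst h1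
        exact absurd (w.fst_mem_support_of_mem_edges he) hu
      · exact h1

theorem aux_internal {V : Type*} {G : SimpleGraph V} {x p q : V} (c : G.Walk x x)
    (hc : c.IsCycle) (P : G.Walk p q) (hP : P.IsPath) (hPc : ∀ e ∈ P.edges, e ∈ c.edges)
    {v y : V} (hv : v ∈ P.support) (hvp : v ≠ p) (hvq : v ≠ q) (hy : s(v, y) ∈ c.edges) :
    s(v, y) ∈ P.edges := by
  obtain ⟨i, hi, hil⟩ := Walk.mem_support_iff_exists_getVert.mp hv
  have hi0 : i ≠ 0 := by rintro rfl; simp at hi; exact hvp hi.symm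
  have hil' : i < P.length := by
    rcases hil.lt_or_eq with h | h
    · exact h
    · subst h; simp at hi; exact absurd hi.symm hvq
  have h2 := hP.ncard_neighborSet_toSubgraph_internal_eq_two hi0 hil'
  rw [hi] at h2
  have h2' := hc.ncard_neighborSet_toSubgraph_eq_two (c.fst_mem_support_of_mem_edges hy)
  have hs : P.toSubgraph.neighborSet v ⊆ c.toSubgraph.neighborSet v := by
    intro z hz
    exact Walk.adj_toSubgraph_iff_mem_edges.mpr
      (hPc _ (Walk.adj_toSubgraph_iff_mem_edges.mp hz))
  have heq := Set.eq_of_subset_of_ncard_le hs (by omega) c.finite_neighborSet_toSubgraph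
  have hz : y ∈ c.toSubgraph.neighborSet v := Walk.adj_toSubgraph_iff_mem_edges.mpr hy
  rw [← heq] at hz
  exact Walk.adj_toSubgraph_iff_mem_edges.mp hz

theorem aux_arc' {V : Type*} {G : SimpleGraph V} {p q : V} (c : G.Walk p p)
    (hc : c.IsCycle) (P : G.Walk p q) (hP : P.IsPath) (hPc : ∀ e ∈ P.edges, e ∈ c.edges)
    (hlen : 1 ≤ P.length) (hsnd : c.snd = P.snd) :
    ∃ R : G.Walk q p, (∀ v ∈ R.support, v ∈ c.support) ∧
      ∀ v ∈ R.support, v ∈ P.support → v = p ∨ v = q := by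
  have key : ∀ i, i ≤ P.length → i < c.length ∧ P.getVert i = c.getVert i := by
    intro i
    induction i using Nat.strong_induction_on with
    | _ i ih =>
      intro hi
      have h3 := hc.three_le_length
      match i, ih, hi with
      | 0, _, _ => simp; omega
      | 1, _, _ => exact ⟨by omega, hsnd.symm⟩
      | i + 2, ih, hi =>
        obtain ⟨h1, h1'⟩ := ih (i + 1) (by omega) (by omega)
        obtain ⟨h0, h0'⟩ := ih i (by omega) (by omega)
        have hadj : P.getVert (i + 2) ∈ c.toSubgraph.neighborSet (c.getVert (i + 1)) := by
          apply Walk.adj_toSubgraph_iff_mem_edges.mpr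
          rw [← h1']
          apply hPc
          exact Walk.adj_toSubgraph_iff_mem_edges.mp
            (P.toSubgraph_adj_getVert (i := i + 1) (by omega))
        rw [hc.neighborSet_toSubgraph_internal (by omega) h1] at hadj
        have heq : P.getVert (i + 2) = c.getVert (i + 2) := by
          rcases hadj with h | h
          · exfalso
            simp only [Nat.add_sub_cancel] at h
            rw [← h0'] at h
            have := hP.getVert_injOn (by simpa using hi) (by simp; omega) h
            omega
          · exact h
        refine ⟨?_, heq⟩
        by_contra hcon
        have : i + 2 = c.length := by omega
        rw [this, Walk.getVert_length] at heq
        rw [← this] at heq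
        have := (hP.getVert_eq_start_iff hi).mp heq
        omega
  obtain ⟨hlt, hq⟩ := key _ le_rfl
  rw [Walk.getVert_length] at hq
  refine ⟨(c.drop P.length).copy hq.symm rfl, ?_, ?_⟩
  · intro v hv
    rw [Walk.support_copy] at hv
    obtain ⟨j, hj, -⟩ := Walk.mem_support_iff_exists_getVert.mp hv
    rw [Walk.drop_getVert] at hj
    rw [← hj]
    exact c.getVert_mem_support _
  · intro v hv hvP
    rw [Walk.support_copy] at hv
    obtain ⟨j, hj, hjl⟩ := Walk.mem_support_iff_exists_getVert.mp hv
    rw [Walk.drop_getVert] at hj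
    rw [Walk.drop_length] at hjl
    obtain ⟨i, hi, hil⟩ := Walk.mem_support_iff_exists_getVert.mp hvP
    rcases Nat.eq_zero_or_pos i with h0 | h0
    · left; rw [← hi, h0]; simp
    · right
      obtain ⟨k1, k2⟩ := key i hil
      have := hc.getVert_injOn (show 1 ≤ i ∧ i ≤ c.length by omega)
        (show 1 ≤ P.length + j ∧ P.length + j ≤ c.length by omega)
        (by rw [← k2, hi, hj])
      have : i = P.length := by omega
      rw [← hi, this, Walk.getVert_length]

theorem aux_arc {V : Type*} [DecidableEq V] {G : SimpleGraph V} {x p q : V} (c : G.Walk x x)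
    (hc : c.IsCycle) (P : G.Walk p q) (hP : P.IsPath) (hPc : ∀ e ∈ P.edges, e ∈ c.edges)
    (hlen : 1 ≤ P.length) :
    ∃ R : G.Walk q p, (∀ v ∈ R.support, v ∈ c.support) ∧
      ∀ v ∈ R.support, v ∈ P.support → v = p ∨ v = q := by
  have hnil : ¬ P.Nil := by rw [Walk.not_nil_iff_lt_length]; omega
  have he : s(p, P.snd) ∈ c.edges :=
    hPc _ (Walk.adj_toSubgraph_iff_mem_edges.mp (P.toSubgraph_adj_snd hnil))
  have hp : p ∈ c.support := c.fst_mem_support_of_mem_edges he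
  have hedge : ∀ e, e ∈ (c.rotate p hp).edges ↔ e ∈ c.edges :=
    fun e => (c.rotate_edges p hp).mem_iff
  have hsupp : ∀ v, v ∈ (c.rotate p hp).support ↔ v ∈ c.support :=
    fun v => by rw [Walk.mem_support_rotate_iff]
  have hc' := hc.rotate hp
  have hmem : P.snd ∈ (c.rotate p hp).toSubgraph.neighborSet p :=
    Walk.adj_toSubgraph_iff_mem_edges.mpr ((hedge _).mpr he)
  rw [hc'.neighborSet_toSubgraph_endpoint] at hmem
  rcases hmem with h | h
  · obtain ⟨R, h1, h2⟩ := aux_arc' _ hc' P hP (fun e he => (hedge e).mpr (hPc e he)) hlen h.symm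
    exact ⟨R, fun v hv => (hsupp v).mp (h1 v hv), h2⟩
  · obtain ⟨R, h1, h2⟩ := aux_arc' _ hc'.reverse P hP
      (fun e he => by rw [Walk.edges_reverse, List.mem_reverse]; exact (hedge e).mpr (hPc e he))
      hlen (by rw [Walk.snd_reverse]; exact h.symm)
    exact ⟨R, fun v hv => (hsupp v).mp (by simpa using h1 v hv), h2⟩

theorem aux_shortest {V : Type*} [DecidableEq V] {G : SimpleGraph V} {u v : V} (R : G.Walk u v) :
    ∃ S : G.Walk u v, S.IsPath ∧ S.support ⊆ R.support ∧
      ∀ y z, y ∈ S.support → z ∈ S.support → G.Adj y z → s(y, z) ∈ S.edges := by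
  classical
  have hex : ∃ n, ∃ S : G.Walk u v, S.support ⊆ R.support ∧ S.length = n :=
    ⟨_, R, fun _ h => h, rfl⟩
  obtain ⟨S, hS, hSl⟩ := Nat.find_spec hex
  have hmin : ∀ T : G.Walk u v, T.support ⊆ R.support → S.length ≤ T.length := by
    intro T hT
    rw [hSl]
    exact Nat.find_min' hex ⟨T, hT, rfl⟩
  have hpath : S.IsPath := by
    have h1 := hmin S.bypass (fun _ h => hS (S.support_bypass_subset_support h))
    have := S.bypass_eq_self_of_length_le_length_bypass h1
    rw [← this]
    exact S.bypass_isPath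
  refine ⟨S, hpath, hS, ?_⟩
  have main : ∀ i j, i < j → j ≤ S.length → G.Adj (S.getVert i) (S.getVert j) → j = i + 1 := by
    intro i j hij hj hadj
    have := hmin ((S.take i).append (Walk.cons hadj (S.drop j))) (by
      intro z hz
      apply hS
      rw [Walk.mem_support_append_iff, Walk.support_cons, List.mem_cons] at hz
      rcases hz with h | h | h
      · obtain ⟨k, hk, -⟩ := Walk.mem_support_iff_exists_getVert.mp h
        rw [Walk.take_getVert] at hk
        rw [← hk]; exact S.getVert_mem_support _
      · rw [h]; exact S.getVert_mem_support _
      · obtain ⟨k, hk, -⟩ := Walk.mem_support_iff_exists_getVert.mp h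
        rw [Walk.drop_getVert] at hk
        rw [← hk]; exact S.getVert_mem_support _)
    rw [Walk.length_append, Walk.length_cons, Walk.take_length, Walk.drop_length] at this
    omega
  have main2 : ∀ i, i < S.length → s(S.getVert i, S.getVert (i + 1)) ∈ S.edges := fun i hi =>
    Walk.adj_toSubgraph_iff_mem_edges.mp (S.toSubgraph_adj_getVert hi)
  intro y z hy hz hadj
  obtain ⟨i, rfl, hi⟩ := Walk.mem_support_iff_exists_getVert.mp hy
  obtain ⟨j, rfl, hj⟩ := Walk.mem_support_iff_exists_getVert.mp hz
  rcases lt_trichotomy i j with h | h | h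
  · have := main i j h hj hadj
    subst this
    exact main2 i (by omega)
  · subst h; exact absurd hadj (G.irrefl)
  · have := main j i h hi hadj.symm
    subst this
    rw [Sym2.eq_swap]
    exact main2 j (by omega)

/-- a subpath `P` (of length ≥ 2, with no internal vertex incident to a
chord of the cycle `C`) of an induced-path section `Q` of `C` extends to a hole `H`
with `V(P) ⊊ V(H) ⊆ V(C)` containing a vertex of `C` not on `Q`. -/
theorem stmt2 {V : Type*} [Fintype V] [DecidableEq V] (G : SimpleGraph V)
    {x : V} (c : G.Walk x x) (hc : c.IsCycle) (hclen : 4 ≤ c.length)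
    {a b : V} (Q : G.Walk a b) (hQpath : Q.IsPath)
    (hQsec : ∀ e ∈ Q.edges, e ∈ c.edges)
    (hQind : ∀ y z : V, y ∈ Q.support → z ∈ Q.support → G.Adj y z → s(y, z) ∈ Q.edges)
    {p q : V} (P : G.Walk p q) (hPpath : P.IsPath)
    (hPQ : ∀ e ∈ P.edges, e ∈ Q.edges) (hPlen : 2 ≤ P.length)
    (hPnochord : ∀ v : V, v ∈ P.support → v ≠ p → v ≠ q →
      ∀ y : V, G.Adj v y → y ∈ c.support → s(v, y) ∈ c.edges) :
    ∃ (r : V) (w : G.Walk r r), IsHole G w ∧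
      (∀ e ∈ P.edges, e ∈ w.edges) ∧
      {z | z ∈ P.support} ⊂ {z | z ∈ w.support} ∧
      {z | z ∈ w.support} ⊆ {z | z ∈ c.support} ∧
      ∃ z : V, z ∈ w.support ∧ z ∈ c.support ∧ z ∉ Q.support := by
  have hPc : ∀ e ∈ P.edges, e ∈ c.edges := fun e he => hQsec e (hPQ e he)
  have hpq : p ≠ q := by
    rintro rfl
    have h0 := Walk.length_eq_zero_iff.mpr (Walk.isPath_iff_nil.mp hPpath)
    omega
  have hPQs : ∀ v ∈ P.support, v ∈ Q.support := by
    intro v hv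
    have hnil : ¬ P.Nil := by rw [Walk.not_nil_iff_lt_length]; omega
    obtain ⟨e, he, hve⟩ := (Walk.mem_support_iff_exists_mem_edges_of_not_nil hnil).mp hv
    exact Walk.mem_support_of_mem_edges (hPQ e he) hve
  -- the path `P` is induced
  have hPind : ∀ y z, y ∈ P.support → z ∈ P.support → G.Adj y z → s(y, z) ∈ P.edges := by
    have hin : ∀ y z, y ∈ P.support → y ≠ p → y ≠ q → z ∈ P.support → G.Adj y z →
        s(y, z) ∈ P.edges := by
      intro y z hy hyp hyq hz hadj
      exact aux_internal c hc P hPpath hPc hy hyp hyq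
        (hQsec _ (hQind y z (hPQs y hy) (hPQs z hz) hadj))
    have hnadj : ¬ G.Adj p q := by
      intro hadj
      have hcyc : (P.append (Walk.cons hadj.symm Walk.nil)).IsCycle := by
        apply hPpath.isCycle_append
        · simp [Walk.cons_isPath_iff, hpq.symm]
        · intro v hv hv'
          simp only [Walk.support_cons, Walk.support_nil, List.tail_cons, List.mem_singleton] at hv'
          subst hv'
          have h1 := hPpath.support_nodup
          rw [← Walk.cons_tail_support] at h1
          exact (List.nodup_cons.mp h1).1 hv
        · left; omega
      apply aux_path_no_cycle Q hQpath _ hcyc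
      intro e he
      rw [Walk.edges_append, List.mem_append] at he
      rcases he with h | h
      · exact hPQ e h
      · simp only [Walk.edges_cons, Walk.edges_nil, List.mem_singleton] at h
        rw [h]
        exact hQind _ _ (hPQs _ P.end_mem_support) (hPQs _ P.start_mem_support) hadj.symm
    intro y z hy hz hadj
    by_cases h1 : y ≠ p ∧ y ≠ q
    · exact hin y z hy h1.1 h1.2 hz hadj
    by_cases h2 : z ≠ p ∧ z ≠ q
    · rw [Sym2.eq_swap]
      exact hin z y hz h2.1 h2.2 hy hadj.symm
    exfalso
    have h1' : y = p ∨ y = q := by tauto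
    have h2' : z = p ∨ z = q := by tauto
    rcases h1' with rfl | rfl <;> rcases h2' with rfl | rfl
    · exact G.irrefl hadj
    · exact hnadj hadj
    · exact hnadj hadj.symm
    · exact G.irrefl hadj
  have hnadj : ¬ G.Adj q p := by
    intro hadj
    have h1 := hPind _ _ P.end_mem_support P.start_mem_support hadj
    have hcyc : (P.append (Walk.cons hadj Walk.nil)).IsCycle := by
      apply hPpath.isCycle_append
      · simp [Walk.cons_isPath_iff, hpq.symm]
      · intro v hv hv'
        simp only [Walk.support_cons, Walk.support_nil, List.tail_cons, List.mem_singleton] at hv'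
        subst hv'
        have h1 := hPpath.support_nodup
        rw [← Walk.cons_tail_support] at h1
        exact (List.nodup_cons.mp h1).1 hv
      · left; omega
    apply aux_path_no_cycle P hPpath _ hcyc
    intro e he
    rw [Walk.edges_append, List.mem_append] at he
    rcases he with h | h
    · exact h
    · simp only [Walk.edges_cons, Walk.edges_nil, List.mem_singleton] at h
      rw [h]; exact h1
  obtain ⟨R, hRc, hRP⟩ := aux_arc c hc P hPpath hPc (by omega)
  obtain ⟨S, hSpath, hSR, hSind⟩ := aux_shortest R
  have hSlen : 2 ≤ S.length := by
    by_contra hcon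
    have : S.length = 0 ∨ S.length = 1 := by omega
    rcases this with h | h
    · exact hpq (Walk.eq_of_length_eq_zero h).symm
    · exact hnadj (Walk.adj_of_length_eq_one h)
  have hSP : ∀ v ∈ S.support, v ∈ P.support → v = p ∨ v = q :=
    fun v hv => hRP v (hSR hv)
  have hPsc : ∀ v ∈ P.support, v ∈ c.support := by
    intro v hv
    have hnil : ¬ P.Nil := by rw [Walk.not_nil_iff_lt_length]; omega
    obtain ⟨e, he, hve⟩ := (Walk.mem_support_iff_exists_mem_edges_of_not_nil hnil).mp hv
    exact Walk.mem_support_of_mem_edges (hPc e he) hve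
  have hcyc : (P.append S).IsCycle := by
    apply hPpath.isCycle_append hSpath
    · intro v hv hv'
      have h1 := hPpath.support_nodup
      rw [← Walk.cons_tail_support] at h1
      have h2 := hSpath.support_nodup
      rw [← Walk.cons_tail_support] at h2
      rcases hSP v (List.mem_of_mem_tail hv') (List.mem_of_mem_tail hv) with rfl | rfl
      · exact (List.nodup_cons.mp h1).1 hv
      · exact (List.nodup_cons.mp h2).1 hv'
    · left; omega
  have hmix : ∀ y z, y ∈ P.support → z ∈ S.support → G.Adj y z →
      s(y, z) ∈ P.edges ∨ s(y, z) ∈ S.edges := by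
    intro y z hy hz hadj
    by_cases h1 : y = p
    · right; subst h1; exact hSind _ _ S.end_mem_support hz hadj
    by_cases h2 : y = q
    · right; subst h2; exact hSind _ _ S.start_mem_support hz hadj
    left
    exact aux_internal c hc P hPpath hPc hy h1 h2
      (hPnochord y hy h1 h2 z hadj (hRc z (hSR hz)))
  have hsub : ∀ z, z ∈ (P.append S).support → z ∈ c.support := by
    intro z hz
    rw [Walk.mem_support_append_iff] at hz
    rcases hz with h | h
    · exact hPsc z h
    · exact hRc z (hSR h)
  have hnotQ : ∃ z, z ∈ (P.append S).support ∧ z ∈ c.support ∧ z ∉ Q.support := by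
    by_contra hcon
    push Not at hcon
    apply aux_path_no_cycle Q hQpath _ hcyc
    intro e he
    induction e using Sym2.ind with
    | _ y z =>
      have hy := Walk.fst_mem_support_of_mem_edges _ he
      have hz := Walk.snd_mem_support_of_mem_edges _ he
      exact hQind y z (hcon y hy (hsub y hy)) (hcon z hz (hsub z hz))
        (Walk.adj_of_mem_edges _ he)
  refine ⟨p, P.append S, ⟨hcyc, ?_, ?_⟩, ?_, ?_, hsub, hnotQ⟩
  · rw [Walk.length_append]; omega
  · intro y z hy hz hadj
    rw [Walk.mem_support_append_iff] at hy hz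
    rw [Walk.edges_append, List.mem_append]
    rcases hy with hy | hy <;> rcases hz with hz | hz
    · exact Or.inl (hPind y z hy hz hadj)
    · exact hmix y z hy hz hadj
    · rw [Sym2.eq_swap]; exact hmix z y hz hy hadj.symm
    · exact Or.inr (hSind y z hy hz hadj)
  · intro e he
    rw [Walk.edges_append, List.mem_append]
    exact Or.inl he
  · refine ⟨fun z hz => ?_, fun hcon => ?_⟩
    · exact (Walk.mem_support_append_iff _ _).mpr (Or.inl hz)
    · obtain ⟨z, hz, -, hzQ⟩ := hnotQ
      exact hzQ (hPQs z (hcon hz))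
end

section
/- Let G be a finite simple graph containing a hole H, an induced path P, and two nonadjacent vertices u and v on H that are not on P, such that (i) v is nonadjacent in G to every vertex of P, and (ii) each of the two (u,v)-sections of H has an internal vertex adjacent to some vertex of P. Then G has a hole that does not contain u, contains the two consecutive edges of H incident to v, and contains a vertex of P that is not on H. -/
open SimpleGraph

variable {V : Type*}

theorem aux_snd {V : Type*} [DecidableEq V] {G : SimpleGraph V} {v u : V} (T : G.Walk v u)
    (hT : T.IsPath) (huv : u ≠ v) (hnadj : ¬ G.Adj u v) :
    ∃ x, G.Adj v x ∧ s(v, x) ∈ T.edges ∧ x ∈ T.support ∧ x ≠ u ∧ x ≠ v ∧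
      (∀ z, s(v, z) ∈ T.edges → z = x) ∧
      ∀ w ∈ T.support, w ≠ u → w ≠ v →
        ∃ W : G.Walk x w, ∀ z ∈ W.support, z ∈ T.support ∧ z ≠ u ∧ z ≠ v := by
  cases T with
  | nil => exact absurd rfl huv
  | @cons _ x _ hx t =>
    rw [Walk.cons_isPath_iff] at hT
    refine ⟨x, hx, by simp, by simp, ?_, hx.ne', ?_, ?_⟩
    · rintro rfl; exact hnadj hx.symm
    · intro z hz
      rw [Walk.edges_cons, List.mem_cons] at hz
      rcases hz with hz | hz
      · exact Sym2.congr_right.1 hz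
      · exact absurd (Walk.fst_mem_support_of_mem_edges _ hz) hT.2
    · intro w hw hwu hwv
      have hw' : w ∈ t.support := by
        rw [Walk.support_cons, List.mem_cons] at hw
        exact hw.resolve_left hwv
      refine ⟨t.takeUntil w hw', fun z hz => ?_⟩
      have hzt : z ∈ t.support := t.support_takeUntil_subset_support hw' hz
      refine ⟨by simp [hzt], ?_, ?_⟩
      · rintro rfl
        exact Walk.endpoint_notMem_support_takeUntil hT.1 hw' hwu.symm hz
      · rintro rfl; exact hT.2 hzt

theorem aux_induced {V : Type*} [DecidableEq V] {G : SimpleGraph V} (S : Set V) {x y : V}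
    (R : G.Walk x y) (hR : ∀ z ∈ R.support, z ∈ S) :
    ∃ W : G.Walk x y, W.IsPath ∧ (∀ z ∈ W.support, z ∈ S) ∧
      ∀ a b : V, a ∈ W.support → b ∈ W.support → G.Adj a b → s(a, b) ∈ W.edges := by
  classical
  have hex : ∃ n, ∃ W : G.Walk x y, W.length = n ∧ ∀ z ∈ W.support, z ∈ S :=
    ⟨_, R, rfl, hR⟩
  obtain ⟨W, hWl, hWS⟩ := Nat.find_spec hex
  have hmin : ∀ W' : G.Walk x y, (∀ z ∈ W'.support, z ∈ S) → W.length ≤ W'.length := by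
    intro W' h'
    rw [hWl]
    exact Nat.find_min' hex ⟨W', rfl, h'⟩
  refine ⟨W, ?_, hWS, ?_⟩
  · have h1 := hmin W.bypass (fun z hz => hWS z (W.support_bypass_subset_support hz))
    rw [← Walk.bypass_eq_self_of_length_le_length_bypass W h1]
    exact W.bypass_isPath
  · have key : ∀ i j : ℕ, i < j → j ≤ W.length → G.Adj (W.getVert i) (W.getVert j) →
        s(W.getVert i, W.getVert j) ∈ W.edges := by
      intro i j hij hj hadj
      by_cases hji : j = i + 1
      · subst hji
        exact (Walk.mk_mem_edges_iff_exists W).2 ⟨i, by omega, by simp⟩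
      · exfalso
        have h1 := hmin ((W.take i).append (Walk.cons hadj (W.drop j))) (by
          intro z hz
          rw [Walk.mem_support_append_iff, Walk.support_cons, List.mem_cons] at hz
          rcases hz with hz | rfl | hz
          · exact hWS _ ((Walk.isSubwalk_take W i).support_subset hz)
          · exact hWS _ (Walk.getVert_mem_support _ _)
          · exact hWS _ ((Walk.isSubwalk_drop W j).support_subset hz))
        simp only [Walk.length_append, Walk.length_cons, Walk.take_length, Walk.drop_length] at h1
        omega
    intro a b ha hb hab
    obtain ⟨i, rfl, hi⟩ := Walk.mem_support_iff_exists_getVert.1 ha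
    obtain ⟨j, rfl, hj⟩ := Walk.mem_support_iff_exists_getVert.1 hb
    rcases lt_trichotomy i j with hij | hij | hij
    · exact key i j hij hj hab
    · subst hij; exact absurd rfl hab.ne
    · rw [Sym2.eq_swap]; exact key j i hij hi hab.symm

theorem aux_cross {V : Type*} {G : SimpleGraph V} (A B : Set V)
    (hAB : ∀ a ∈ A, ∀ b ∈ B, ¬ G.Adj a b) (hd : ∀ a ∈ A, a ∉ B) {x y : V}
    (R : G.Walk x y) (hx : x ∈ A) (hy : y ∈ B) : ∃ z ∈ R.support, z ∉ A ∧ z ∉ B := by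
  induction R with
  | nil => exact absurd hy (hd _ hx)
  | @cons x x' y hadj t ih =>
    by_cases h1 : x' ∈ A
    · obtain ⟨z, hz, hz'⟩ := ih h1 hy
      exact ⟨z, by simp [hz], hz'⟩
    · refine ⟨x', by simp, h1, fun h2 => hAB _ hx _ h2 hadj⟩

theorem aux_split {V : Type*} [DecidableEq V] {G : SimpleGraph V} {a : V} (h : G.Walk a a)
    (hc : h.IsCycle) (u v : V) (hu : u ∈ h.support) (hv : v ∈ h.support) (huv : u ≠ v) :
    ∃ T D : G.Walk v u, T.IsPath ∧ D.IsPath ∧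
      (∀ e, e ∈ h.edges ↔ e ∈ T.edges ∨ e ∈ D.edges) ∧
      (∀ z, z ∈ h.support ↔ z ∈ T.support ∨ z ∈ D.support) ∧
      (∀ z, z ∈ T.support → z ∈ D.support → z = u ∨ z = v) := by
  have hc' := hc.rotate hv
  have hu' : u ∈ (h.rotate v hv).support := by
    rwa [Walk.mem_support_rotate_iff]
  have hspec := Walk.take_spec (h.rotate v hv) hu'
  set T := (h.rotate v hv).takeUntil u hu' with hTdef
  set D := (h.rotate v hv).dropUntil u hu' with hDdef
  have hnd := hc'.support_nodup
  rw [← hspec, Walk.tail_support_append] at hnd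
  have hT : T.IsPath := hc'.isPath_takeUntil hu'
  have hD : D.reverse.IsPath := by
    rw [Walk.isPath_reverse_iff, Walk.isPath_def, Walk.support_eq_cons, List.nodup_cons]
    refine ⟨?_, (List.nodup_append.1 hnd).2.1⟩
    intro hmem
    have : u ∈ T.support.tail := by
      have := T.end_mem_support
      rw [Walk.support_eq_cons, List.mem_cons] at this
      exact this.resolve_left huv
    exact (List.nodup_append.1 hnd).2.2 _ this _ hmem rfl
  refine ⟨T, D.reverse, hT, hD, ?_, ?_, ?_⟩
  · intro e
    rw [← (h.rotate_edges v hv).mem_iff, ← hspec, Walk.edges_append]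
    simp
  · intro z
    rw [← Walk.mem_support_rotate_iff h v hv, ← hspec, Walk.mem_support_append_iff]
    simp
  · intro z hzT hzD
    by_contra hcon
    push Not at hcon
    rw [Walk.support_reverse, List.mem_reverse, Walk.support_eq_cons, List.mem_cons] at hzD
    rw [Walk.support_eq_cons, List.mem_cons] at hzT
    exact (List.nodup_append.1 hnd).2.2 _ (hzT.resolve_left hcon.2) _
      (hzD.resolve_left hcon.1) rfl

/-- given a hole `h`, an induced path `P`, and nonadjacent vertices
`u, v` on `h` not on `P` with (i) `v` nonadjacent to every vertex of `P` and
(ii) each `(u,v)`-section of `h` having an internal vertex adjacent to a vertex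
of `P`, there is a hole avoiding `u`, containing both edges of `h` at `v`, and
containing a vertex of `P` not on `h`. -/
theorem stmt3 {V : Type*} [Fintype V] [DecidableEq V] (G : SimpleGraph V)
    {a : V} (h : G.Walk a a) (hh : IsHole G h)
    {p q : V} (P : G.Walk p q) (hPpath : P.IsPath)
    (hPind : ∀ y z : V, y ∈ P.support → z ∈ P.support → G.Adj y z → s(y, z) ∈ P.edges)
    (u v : V) (hu : u ∈ h.support) (hv : v ∈ h.support)
    (huv : u ≠ v) (hnadj : ¬ G.Adj u v)
    (huP : u ∉ P.support) (hvP : v ∉ P.support)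
    (hi : ∀ z ∈ P.support, ¬ G.Adj v z)
    (hii : ∀ S : G.Walk u v, S.IsPath → (∀ e ∈ S.edges, e ∈ h.edges) →
      ∃ w : V, w ∈ S.support ∧ w ≠ u ∧ w ≠ v ∧ ∃ z ∈ P.support, G.Adj w z) :
    ∃ (b : V) (w : G.Walk b b), IsHole G w ∧ u ∉ w.support ∧
      (∀ e ∈ h.edges, v ∈ e → e ∈ w.edges) ∧
      ∃ z : V, z ∈ P.support ∧ z ∈ w.support ∧ z ∉ h.support := by
  classical
  obtain ⟨hc, -, hind⟩ := hh
  obtain ⟨T, D, hT, hD, hE, hS, hTD⟩ := aux_split h hc u v hu hv huv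
  obtain ⟨x, hvx, hvxe, hxT, hxu, hxv, hxuniq, hxW⟩ := aux_snd T hT huv hnadj
  obtain ⟨y, hvy, hvye, hyD, hyu, hyv, hyuniq, hyW⟩ := aux_snd D hD huv hnadj
  obtain ⟨w1, hw1, hw1u, hw1v, z1, hz1, hadj1⟩ := hii T.reverse hT.reverse (by
    intro e he; rw [hE]; left; simpa using he)
  obtain ⟨w2, hw2, hw2u, hw2v, z2, hz2, hadj2⟩ := hii D.reverse hD.reverse (by
    intro e he; rw [hE]; right; simpa using he)
  obtain ⟨W1, hW1⟩ := hxW w1 (by simpa using hw1) hw1u hw1v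
  obtain ⟨W2, hW2⟩ := hyW w2 (by simpa using hw2) hw2u hw2v
  let A : Set V := {z | z ∈ T.support ∧ z ≠ u ∧ z ≠ v}
  let B : Set V := {z | z ∈ D.support ∧ z ≠ u ∧ z ≠ v}
  have hd : ∀ a ∈ A, a ∉ B := by
    rintro a ⟨h1, h2, h3⟩ ⟨h4, -, -⟩
    rcases hTD a h1 h4 with h | h
    · exact h2 h
    · exact h3 h
  have hAB : ∀ a ∈ A, ∀ b ∈ B, ¬ G.Adj a b := by
    intro a ha b hb hab
    have := hind a b ((hS a).2 (Or.inl ha.1)) ((hS b).2 (Or.inr hb.1)) hab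
    rcases (hE _).1 this with h1 | h1
    · exact hd b ⟨Walk.snd_mem_support_of_mem_edges _ h1, hb.2⟩ hb
    · exact hd a ha ⟨Walk.fst_mem_support_of_mem_edges _ h1, ha.2⟩
  let S : Set V := A ∪ B ∪ {z | z ∈ P.support}
  let M : G.Walk z1 z2 := (P.takeUntil z1 hz1).reverse.append (P.takeUntil z2 hz2)
  have hM : ∀ z ∈ M.support, z ∈ P.support := by
    intro z hz
    rw [Walk.mem_support_append_iff, Walk.support_reverse, List.mem_reverse] at hz
    rcases hz with hz | hz
    · exact P.support_takeUntil_subset_support _ hz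
    · exact P.support_takeUntil_subset_support _ hz
  obtain ⟨R, hRp, hRS, hRind⟩ := aux_induced S
    (W1.append (Walk.cons hadj1 (M.append (Walk.cons hadj2.symm W2.reverse)))) (by
      intro z hz
      simp only [Walk.mem_support_append_iff, Walk.support_cons, List.mem_cons,
        Walk.support_reverse, List.mem_reverse] at hz
      rcases hz with hz | rfl | hz | rfl | hz
      · exact Or.inl (Or.inl (hW1 z hz))
      · exact Or.inl (Or.inl (hW1 _ W1.end_mem_support))
      · exact Or.inr (hM z hz)
      · exact Or.inr hz2
      · exact Or.inl (Or.inr (hW2 z hz)))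
  have hxA : x ∈ A := ⟨hxT, hxu, hxv⟩
  have hyB : y ∈ B := ⟨hyD, hyu, hyv⟩
  have hxy : x ≠ y := by rintro rfl; exact hd _ hxA hyB
  have hnxy : ¬ G.Adj x y := hAB x hxA y hyB
  have hvR : v ∉ R.support := by
    intro hm
    rcases hRS v hm with (h1 | h1) | h1
    · exact h1.2.2 rfl
    · exact h1.2.2 rfl
    · exact hvP h1
  have huR : u ∉ R.support := by
    intro hm
    rcases hRS u hm with (h1 | h1) | h1
    · exact h1.2.1 rfl
    · exact h1.2.1 rfl
    · exact huP h1
  have hlen : 2 ≤ R.length := by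
    by_contra hcon
    have h01 : R.length = 0 ∨ R.length = 1 := by omega
    rcases h01 with h0 | h1
    · exact hxy (Walk.eq_of_length_eq_zero h0)
    · exact hnxy (Walk.adj_of_length_eq_one h1)
  have hsupp : ∀ z, z ∈ (Walk.cons hvx (R.concat hvy.symm)).support ↔ z = v ∨ z ∈ R.support := by
    intro z
    simp only [Walk.support_cons, Walk.support_concat, List.concat_eq_append, List.mem_cons,
      List.mem_append, List.not_mem_nil, or_false]
    tauto
  have hedges : ∀ e, e ∈ (Walk.cons hvx (R.concat hvy.symm)).edges ↔
      e = s(v, x) ∨ e ∈ R.edges ∨ e = s(y, v) := by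
    intro e
    simp [Walk.edges_cons, Walk.edges_concat, List.concat_eq_append]
  have hvadj : ∀ z, s(v, z) ∈ h.edges → z = x ∨ z = y := by
    intro z hz
    rcases (hE _).1 hz with h1 | h1
    · exact Or.inl (hxuniq z h1)
    · exact Or.inr (hyuniq z h1)
  have hvadj' : ∀ z ∈ R.support, G.Adj v z → z = x ∨ z = y := by
    intro z hz hadj
    rcases hRS z hz with (h1 | h1) | h1
    · exact hvadj z (hind _ _ hv ((hS z).2 (Or.inl h1.1)) hadj)
    · exact hvadj z (hind _ _ hv ((hS z).2 (Or.inr h1.1)) hadj)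
    · exact absurd hadj (hi z h1)
  have hve : ∀ z, z = x ∨ z = y → s(v, z) ∈ (Walk.cons hvx (R.concat hvy.symm)).edges := by
    intro z hz
    rw [hedges]
    rcases hz with rfl | rfl
    · exact Or.inl rfl
    · exact Or.inr (Or.inr Sym2.eq_swap)
  refine ⟨v, Walk.cons hvx (R.concat hvy.symm), ⟨?_, ?_, ?_⟩, ?_, ?_, ?_⟩
  · rw [Walk.cons_isCycle_iff]
    refine ⟨hRp.concat hvR _, ?_⟩
    rw [Walk.edges_concat, List.concat_eq_append, List.mem_append, List.mem_singleton]
    rintro (h1 | h1)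
    · exact hvR (Walk.fst_mem_support_of_mem_edges _ h1)
    · rw [Sym2.eq_iff] at h1
      rcases h1 with ⟨h1, -⟩ | ⟨-, h1⟩
      · exact hyv h1.symm
      · exact hxy h1
  · simp only [Walk.length_cons, Walk.length_concat]; omega
  · intro b c hb hc' hbc
    rw [hsupp] at hb hc'
    rcases hb with rfl | hb
    · rcases hc' with rfl | hc'
      · exact absurd rfl hbc.ne
      · exact hve c (hvadj' c hc' hbc)
    · rcases hc' with rfl | hc'
      · rw [Sym2.eq_swap]; exact hve b (hvadj' b hb hbc.symm)
      · exact (hedges _).2 (Or.inr (Or.inl (hRind b c hb hc' hbc)))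
  · rw [hsupp]
    rintro (h1 | h1)
    · exact huv h1
    · exact huR h1
  · intro e he hve'
    obtain ⟨z, rfl⟩ := Sym2.mem_iff_exists.1 hve'
    exact hve z (hvadj z he)
  · obtain ⟨z, hzR, hzA, hzB⟩ := aux_cross A B hAB hd R hxA hyB
    have hzP : z ∈ P.support := by
      rcases hRS z hzR with (h1 | h1) | h1
      · exact absurd h1 hzA
      · exact absurd h1 hzB
      · exact h1
    refine ⟨z, hzP, (hsupp z).2 (Or.inr hzR), ?_⟩
    have hzu : z ≠ u := by rintro rfl; exact huP hzP
    have hzv : z ≠ v := by rintro rfl; exact hvP hzP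
    intro hzh
    rcases (hS z).1 hzh with h1 | h1
    · exact hzA ⟨h1, hzu, hzv⟩
    · exact hzB ⟨h1, hzu, hzv⟩
end

section
/- Let G be a finite simple graph and u a vertex of G satisfying the NC property. Let G* be the graph obtained from G by locally chordalizing, by u, every hole of G containing u (i.e., adding all edges joining u to vertices nonadjacent to u on holes of G through u). Then every hole of G* is already a hole of G; that is, the local chordalization creates no new hole. -/
open SimpleGraph

variable {V : Type*}

/-- Cyclic indexing of a hole through `u`. -/
theorem hole_index (G : SimpleGraph V) {a u : V} (w : G.Walk a a) (hw : IsHole G w)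
    (hu : u ∈ w.support) :
    ∃ (n : ℕ) (f : ℕ → V), 4 ≤ n ∧ f 0 = u ∧ f n = u ∧
      (∀ i j, i < n → j < n → f i = f j → i = j) ∧
      (∀ i, i < n → G.Adj (f i) (f (i + 1))) ∧
      (∀ i j, i < n → j < n → G.Adj (f i) (f j) →
        j = i + 1 ∨ i = j + 1 ∨ (i = 0 ∧ j + 1 = n) ∨ (j = 0 ∧ i + 1 = n)) ∧
      (∀ i, i < n → s(f i, f (i + 1)) ∈ w.edges) ∧
      (∀ i, f i ∈ w.support) ∧
      (∀ x, x ∈ w.support → ∃ i < n, f i = x) := by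
  classical
  obtain ⟨hc, hl, hch⟩ := hw
  set w' := w.rotate u hu with hw'
  have hc' : w'.IsCycle := (Walk.isCycle_rotate hu).2 hc
  have hed : ∀ e, e ∈ w'.edges ↔ e ∈ w.edges := fun e => (w.rotate_edges u hu).mem_iff
  have hlen : w'.length = w.length := by
    rw [← Walk.length_edges, ← Walk.length_edges]
    exact (w.rotate_edges u hu).perm.length_eq
  have hsup : ∀ x, x ∈ w'.support ↔ x ∈ w.support := fun x => w.mem_support_rotate_iff u hu
  have hinj : ∀ i j, i < w'.length → j < w'.length → w'.getVert i = w'.getVert j → i = j := by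
    intro i j hi hj h
    exact hc'.getVert_injOn' (by simp only [Set.mem_ofPred_eq]; omega)
      (by simp only [Set.mem_ofPred_eq]; omega) h
  refine ⟨w'.length, w'.getVert, by omega, by simp, by simp, hinj, ?_, ?_, ?_, ?_, ?_⟩
  · intro i hi
    exact w'.adj_getVert_succ hi
  · intro i j hi hj hadj
    have he := hch _ _ ((hsup _).1 (w'.getVert_mem_support i))
      ((hsup _).1 (w'.getVert_mem_support j)) hadj
    rw [← hed, Walk.mk_mem_edges_iff_exists] at he
    obtain ⟨k, hk, he⟩ := he
    have h0 : w'.getVert w'.length = w'.getVert 0 := by simp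
    have key : ∀ i j, i < w'.length → j < w'.length → w'.getVert k = w'.getVert i →
        w'.getVert (k + 1) = w'.getVert j → j = i + 1 ∨ (j = 0 ∧ i + 1 = w'.length) := by
      intro i j hi hj h1 h2
      have := hinj _ _ hk hi h1
      subst this
      by_cases hk1 : k + 1 < w'.length
      · left
        exact (hinj _ _ hk1 hj h2).symm
      · have : k + 1 = w'.length := by omega
        right
        rw [this, h0] at h2
        exact ⟨(hinj _ _ (by omega) hj h2).symm, this⟩
    rcases Sym2.eq_iff.1 he with ⟨h1, h2⟩ | ⟨h1, h2⟩
    · have := key i j hi hj h1 h2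
      omega
    · have := key j i hj hi h1 h2
      omega
  · intro i hi
    rw [← hed, Walk.mk_mem_edges_iff_exists]
    exact ⟨i, hi, rfl⟩
  · intro i
    exact (hsup _).1 (w'.getVert_mem_support i)
  · intro x hx
    rw [← hsup, Walk.mem_support_iff_exists_getVert] at hx
    obtain ⟨i, hi, hil⟩ := hx
    by_cases h : i < w'.length
    · exact ⟨i, h, hi⟩
    · have : i = w'.length := by omega
      subst this
      exact ⟨0, by omega, by simpa using hi⟩

/-- Connected vertex sets. -/
def SetConn (G : SimpleGraph V) (T : Set V) : Prop :=
  ∀ x ∈ T, ∀ y ∈ T, ∃ p : G.Walk x y, ∀ z ∈ p.support, z ∈ T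

/-- Two sets meet or are joined by an edge. -/
def Touch (G : SimpleGraph V) (S T : Set V) : Prop :=
  ∃ s ∈ S, ∃ t ∈ T, s = t ∨ G.Adj s t

theorem Touch.symm' {G : SimpleGraph V} {S T : Set V} (h : Touch G S T) : Touch G T S := by
  obtain ⟨s, hs, t, ht, h⟩ := h
  exact ⟨t, ht, s, hs, h.imp Eq.symm fun h => h.symm⟩

theorem SetConn.union {G : SimpleGraph V} {S T : Set V} (hS : SetConn G S) (hT : SetConn G T)
    (h : Touch G S T) : SetConn G (S ∪ T) := by
  obtain ⟨s, hs, t, ht, h⟩ := h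
  have hst : ∃ p : G.Walk s t, ∀ z ∈ p.support, z ∈ S ∪ T := by
    rcases h with rfl | h
    · exact ⟨Walk.nil, by simp [hs]⟩
    · exact ⟨h.toWalk, by simp [hs, ht]⟩
  obtain ⟨p, hp⟩ := hst
  have key : ∀ x ∈ S, ∀ y ∈ T, ∃ q : G.Walk x y, ∀ z ∈ q.support, z ∈ S ∪ T := by
    intro x hx y hy
    obtain ⟨q1, h1⟩ := hS x hx s hs
    obtain ⟨q2, h2⟩ := hT t ht y hy
    refine ⟨q1.append (p.append q2), ?_⟩
    intro z hz
    rw [Walk.mem_support_append_iff, Walk.mem_support_append_iff] at hz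
    rcases hz with hz | hz | hz
    · exact Or.inl (h1 z hz)
    · exact hp z hz
    · exact Or.inr (h2 z hz)
  rintro x (hx | hx) y (hy | hy)
  · obtain ⟨q, hq⟩ := hS x hx y hy
    exact ⟨q, fun z hz => Or.inl (hq z hz)⟩
  · exact key x hx y hy
  · obtain ⟨q, hq⟩ := key y hy x hx
    exact ⟨q.reverse, fun z hz => hq z (by simpa using hz)⟩
  · obtain ⟨q, hq⟩ := hT x hx y hy
    exact ⟨q, fun z hz => Or.inr (hq z hz)⟩

theorem SetConn.singleton (G : SimpleGraph V) (x : V) : SetConn G {x} := by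
  rintro a rfl b rfl
  exact ⟨Walk.nil, by simp⟩

theorem SetConn.interval (G : SimpleGraph V) (f : ℕ → V) (i j : ℕ)
    (h : ∀ k, i ≤ k → k < j → G.Adj (f k) (f (k + 1))) :
    SetConn G (f '' Set.Icc i j) := by
  have key : ∀ d a, i ≤ a → a + d ≤ j →
      ∃ p : G.Walk (f a) (f (a + d)), ∀ z ∈ p.support, z ∈ f '' Set.Icc i j := by
    intro d
    induction d with
    | zero =>
      intro a h1 h2
      exact ⟨Walk.nil, by
        intro z hz
        simp only [Walk.support_nil, List.mem_singleton] at hz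
        exact ⟨a, ⟨h1, h2⟩, hz.symm⟩⟩
    | succ d ih =>
      intro a h1 h2
      obtain ⟨p, hp⟩ := ih a h1 (by omega)
      refine ⟨p.concat (h (a + d) (by omega) (by omega)), ?_⟩
      intro z hz
      rw [Walk.support_concat] at hz
      simp only [List.concat_eq_append, List.mem_append, List.mem_singleton] at hz
      rcases hz with hz | hz
      · exact hp z hz
      · exact ⟨a + d + 1, ⟨by omega, by omega⟩, hz.symm⟩
  rintro _ ⟨a, ⟨ha1, ha2⟩, rfl⟩ _ ⟨b, ⟨hb1, hb2⟩, rfl⟩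
  rcases le_total a b with hab | hab
  · obtain ⟨d, rfl⟩ := Nat.exists_eq_add_of_le hab
    exact key d a ha1 hb2
  · obtain ⟨d, rfl⟩ := Nat.exists_eq_add_of_le hab
    obtain ⟨p, hp⟩ := key d b hb1 ha2
    exact ⟨p.reverse, fun z hz => hp z (by simpa using hz)⟩

/-- Induced paths. -/
def IndPath (G : SimpleGraph V) {a b : V} (p : G.Walk a b) : Prop :=
  p.IsPath ∧ ∀ x y : V, x ∈ p.support → y ∈ p.support → G.Adj x y → s(x, y) ∈ p.edges

theorem IndPath.cons' {G : SimpleGraph V} {a b c : V} {p : G.Walk b c} (hp : IndPath G p)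
    (h : G.Adj a b) (ha : a ∉ p.support) (hn : ∀ x ∈ p.support, G.Adj a x → x = b) :
    IndPath G (Walk.cons h p) := by
  refine ⟨(Walk.cons_isPath_iff h p).2 ⟨hp.1, ha⟩, ?_⟩
  intro x y hx hy hxy
  rw [Walk.support_cons, List.mem_cons] at hx hy
  rw [Walk.edges_cons, List.mem_cons]
  rcases hx with rfl | hx <;> rcases hy with rfl | hy
  · exact absurd hxy (G.irrefl)
  · left
    rw [hn y hy hxy]
  · left
    rw [hn x hx hxy.symm, Sym2.eq_swap]
  · right
    exact hp.2 x y hx hy hxy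

theorem IndPath.extend {G : SimpleGraph V} {v b : V} (p : G.Walk v b) : IndPath G p →
    ∀ a, (∃ x ∈ p.support, a = x ∨ G.Adj a x) →
    ∃ q : G.Walk a b, IndPath G q ∧ ∀ z ∈ q.support, z = a ∨ z ∈ p.support := by
  induction p with
  | nil =>
    intro hp a ha
    rename_i v
    obtain ⟨x, hx, h⟩ := ha
    simp only [Walk.support_nil, List.mem_singleton] at hx
    subst hx
    rcases h with rfl | h
    · exact ⟨Walk.nil, hp, by simp⟩
    · exact ⟨Walk.cons h Walk.nil, hp.cons' h (by simp [h.ne]) (by simp), by simp⟩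
  | cons h p ih =>
    intro hp a ha
    rename_i v v' b
    by_cases hT : ∃ x ∈ p.support, a = x ∨ G.Adj a x
    · have hp' : IndPath G p := by
        have hpp := (Walk.cons_isPath_iff h p).1 hp.1
        refine ⟨hpp.1, ?_⟩
        intro x y hx hy hxy
        have := hp.2 x y (by simp [hx]) (by simp [hy]) hxy
        rw [Walk.edges_cons, List.mem_cons] at this
        rcases this with h' | h'
        · rcases Sym2.eq_iff.1 h' with ⟨rfl, rfl⟩ | ⟨rfl, rfl⟩
          · exact absurd hx hpp.2
          · exact absurd hy hpp.2
        · exact h'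
      obtain ⟨q, hq, hqs⟩ := ih hp' a hT
      refine ⟨q, hq, fun z hz => (hqs z hz).imp id ?_⟩
      intro hz
      simp [hz]
    · push Not at hT
      obtain ⟨x, hx, hax⟩ := ha
      have hxv : x = v := by
        rw [Walk.support_cons, List.mem_cons] at hx
        rcases hx with hx | hx
        · exact hx
        · rcases hax with hax | hax
          · exact absurd hax (hT x hx).1
          · exact absurd hax (hT x hx).2
      subst hxv
      rcases hax with rfl | hax
      · exact ⟨Walk.cons h p, hp, fun z hz => Or.inr hz⟩
      · refine ⟨Walk.cons hax (Walk.cons h p), hp.cons' hax ?_ ?_, ?_⟩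
        · rw [Walk.support_cons, List.mem_cons]
          rintro (rfl | h')
          · exact hax.ne rfl
          · exact (hT _ h').1 rfl
        · intro y hy hay
          rw [Walk.support_cons, List.mem_cons] at hy
          rcases hy with hy | hy
          · exact hy
          · exact absurd hay (hT y hy).2
        · intro z hz
          rwa [Walk.support_cons, List.mem_cons] at hz

theorem exists_indPath {G : SimpleGraph V} {a b : V} (p : G.Walk a b) :
    ∃ q : G.Walk a b, IndPath G q ∧ ∀ z ∈ q.support, z ∈ p.support := by
  induction p with
  | nil => exact ⟨Walk.nil, ⟨by simp, by
      intro x y hx hy h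
      simp only [Walk.support_nil, List.mem_singleton] at hx hy
      subst hx
      subst hy
      exact absurd h (G.irrefl)⟩, by simp⟩
  | cons h p ih =>
    obtain ⟨q, hq, hqs⟩ := ih
    obtain ⟨r, hr, hrs⟩ := IndPath.extend q hq _ ⟨_, q.start_mem_support, Or.inr h⟩
    refine ⟨r, hr, fun z hz => ?_⟩
    rw [Walk.support_cons, List.mem_cons]
    exact (hrs z hz).imp id (hqs z)

/-- Hole construction. -/
theorem exists_hole {G : SimpleGraph V} {T : Set V} (hT : SetConn G T) {x p q : V}
    (hx : x ∉ T) (hp : p ∈ T) (hq : q ∈ T) (hpq : p ≠ q) (hnpq : ¬ G.Adj p q)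
    (hxp : G.Adj x p) (hxq : G.Adj x q)
    (hN : ∀ t ∈ T, G.Adj x t → t = p ∨ t = q) :
    ∃ (P : G.Walk p q) (w : G.Walk x x), (∀ z ∈ P.support, z ∈ T) ∧ IsHole G w ∧
      (∀ z, z ∈ w.support ↔ z = x ∨ z ∈ P.support) ∧
      s(p, x) ∈ w.edges ∧ s(x, q) ∈ w.edges := by
  obtain ⟨P0, hP0⟩ := hT p hp q hq
  obtain ⟨P, hP, hPs⟩ := exists_indPath P0
  have hPT : ∀ z ∈ P.support, z ∈ T := fun z hz => hP0 z (hPs z hz)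
  have hxP : x ∉ P.support := fun h => hx (hPT x h)
  have hlen : 2 ≤ P.length := by
    by_contra hlt
    rcases P with _ | ⟨h, P⟩
    · exact hpq rfl
    · rcases P with _ | ⟨h', P⟩
      · exact hnpq h
      · simp at hlt
  have hsup : ∀ z, z ∈ (Walk.cons hxp (P.concat hxq.symm)).support ↔ z = x ∨ z ∈ P.support := by
    intro z
    rw [Walk.support_cons, List.mem_cons, Walk.support_concat]
    simp only [List.concat_eq_append, List.mem_append, List.mem_singleton]
    tauto
  have hed : ∀ e, e ∈ (Walk.cons hxp (P.concat hxq.symm)).edges ↔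
      e = s(x, p) ∨ e ∈ P.edges ∨ e = s(q, x) := by
    intro e
    rw [Walk.edges_cons, List.mem_cons, Walk.edges_concat]
    simp only [List.concat_eq_append, List.mem_append, List.mem_singleton]
  refine ⟨P, Walk.cons hxp (P.concat hxq.symm), hPT, ⟨?_, ?_, ?_⟩, hsup, ?_, ?_⟩
  · rw [Walk.cons_isCycle_iff]
    refine ⟨hP.1.concat hxP _, ?_⟩
    rw [Walk.edges_concat]
    simp only [List.concat_eq_append, List.mem_append, List.mem_singleton]
    rintro (h | h)
    · exact hxP (P.fst_mem_support_of_mem_edges h)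
    · rcases Sym2.eq_iff.1 h with ⟨h1, h2⟩ | ⟨h1, h2⟩
      · exact hxq.ne h1
      · exact hpq h2
  · rw [Walk.length_cons, Walk.length_concat]
    omega
  · intro y z hy hz hyz
    rw [hsup] at hy hz
    rw [hed]
    rcases hy with rfl | hy <;> rcases hz with rfl | hz
    · exact absurd hyz (G.irrefl)
    · rcases hN z (hPT z hz) hyz with rfl | rfl
      · exact Or.inl rfl
      · exact Or.inr (Or.inr Sym2.eq_swap)
    · rcases hN y (hPT y hy) hyz.symm with rfl | rfl
      · exact Or.inl Sym2.eq_swap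
      · exact Or.inr (Or.inr rfl)
    · exact Or.inr (Or.inl (hP.2 y z hy hz hyz))
  · rw [hed]
    exact Or.inl Sym2.eq_swap
  · rw [hed]
    exact Or.inr (Or.inr Sym2.eq_swap)

/-- `A` is an arm from `v` to (a neighbour of) `u`. -/
def IsArm (G : SimpleGraph V) (u v : V) (A : Set V) : Prop :=
  v ∈ A ∧ u ∉ A ∧ SetConn G A ∧ ∃ a ∈ A, G.Adj u a ∧ ∀ t ∈ A, G.Adj u t → t = a

theorem exists_arm {G : SimpleGraph V} {u v : V} (hNC : VertexNC G u) (huv : v ≠ u)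
    (hv : G.Adj u v ∨ ∃ (a : V) (w : G.Walk a a), IsHole G w ∧ u ∈ w.support ∧ v ∈ w.support)
    {S : Set V} (hS : SetConn G S) (huS : u ∉ S) (hvS : ¬ Touch G {v} S) :
    ∃ A, IsArm G u v A ∧ ¬ Touch G A S := by
  by_cases hadj : G.Adj u v
  · refine ⟨{v}, ⟨rfl, fun h => huv h.symm, SetConn.singleton G v, v, rfl, hadj, ?_⟩, hvS⟩
    intro t ht _
    exact ht
  have hv := hv.resolve_left hadj
  obtain ⟨a, w, hw, hu, hvw⟩ := hv
  obtain ⟨n, f, hn, hf0, hfn, hinj, hsucc, hch, hed, hsup, hex⟩ := hole_index G w hw hu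
  obtain ⟨k, hk, hfk⟩ := hex v hvw
  have hk0 : k ≠ 0 := by
    rintro rfl
    exact huv (hfk.symm.trans hf0)
  have hk1 : k ≠ 1 := by
    rintro rfl
    exact hadj (by rw [← hf0, ← hfk]; exact hsucc 0 (by omega))
  have hk2 : k + 1 ≠ n := by
    intro h
    apply hadj
    have := hsucc k hk
    rw [h, hfn, hfk] at this
    exact this.symm
  have hc1 : ∀ i j, i ≤ j → j ≤ n → SetConn G (f '' Set.Icc i j) := fun i j _ hj =>
    SetConn.interval G f i j (fun l _ hl => hsucc l (by omega))
  have hconnL := hc1 1 (k - 1) (by omega) (by omega)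
  have hconnR := hc1 (k + 1) (n - 1) (by omega) (by omega)
  have harmL : IsArm G u v (f '' Set.Icc 1 k) := by
    refine ⟨⟨k, ⟨by omega, le_rfl⟩, hfk⟩, ?_, hc1 1 k (by omega) (by omega), f 1,
      ⟨1, ⟨le_rfl, by omega⟩, rfl⟩, ?_, ?_⟩
    · rintro ⟨i, ⟨h1, h2⟩, h3⟩
      have := hinj i 0 (by omega) (by omega) (h3.trans hf0.symm)
      omega
    · rw [← hf0]
      exact hsucc 0 (by omega)
    · rintro _ ⟨i, ⟨h1, h2⟩, rfl⟩ h3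
      rw [← hf0] at h3
      have := hch 0 i (by omega) (by omega) h3
      have : i = 1 := by omega
      rw [this]
  have harmR : IsArm G u v (f '' Set.Icc k (n - 1)) := by
    refine ⟨⟨k, ⟨le_rfl, by omega⟩, hfk⟩, ?_, hc1 k (n - 1) (by omega) (by omega), f (n - 1),
      ⟨n - 1, ⟨by omega, by omega⟩, rfl⟩, ?_, ?_⟩
    · rintro ⟨i, ⟨h1, h2⟩, h3⟩
      have := hinj i 0 (by omega) (by omega) (h3.trans hf0.symm)
      omega
    · have := hsucc (n - 1) (by omega)
      rw [show n - 1 + 1 = n by omega, hfn] at this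
      exact this.symm
    · rintro _ ⟨i, ⟨h1, h2⟩, rfl⟩ h3
      rw [← hf0] at h3
      have := hch 0 i (by omega) (by omega) h3
      have : i = n - 1 := by omega
      rw [this]
  by_cases hL : Touch G (f '' Set.Icc 1 k) S
  swap
  · exact ⟨_, harmL, hL⟩
  by_cases hR : Touch G (f '' Set.Icc k (n - 1)) S
  swap
  · exact ⟨_, harmR, hR⟩
  exfalso
  have hL' : Touch G (f '' Set.Icc 1 (k - 1)) S := by
    obtain ⟨_, ⟨i, ⟨h1, h2⟩, rfl⟩, t, ht, h⟩ := hL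
    by_cases hik : i = k
    · subst hik
      exact absurd ⟨_, hfk, t, ht, h⟩ hvS
    · exact ⟨_, ⟨i, ⟨h1, by omega⟩, rfl⟩, t, ht, h⟩
  have hR' : Touch G S (f '' Set.Icc (k + 1) (n - 1)) := by
    apply Touch.symm'
    obtain ⟨_, ⟨i, ⟨h1, h2⟩, rfl⟩, t, ht, h⟩ := hR
    by_cases hik : i = k
    · subst hik
      exact absurd ⟨_, hfk, t, ht, h⟩ hvS
    · exact ⟨_, ⟨i, ⟨by omega, h2⟩, rfl⟩, t, ht, h⟩
  have hT1 : SetConn G (f '' Set.Icc 1 (k - 1) ∪ S) := hconnL.union hS hL'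
  have hT : SetConn G ((f '' Set.Icc 1 (k - 1) ∪ S) ∪ f '' Set.Icc (k + 1) (n - 1)) := by
    refine hT1.union hconnR ?_
    obtain ⟨s, hs, t, ht, h⟩ := hR'
    exact ⟨s, Or.inr hs, t, ht, h⟩
  have hne : f (k - 1) ≠ f (k + 1) := by
    intro h
    have := hinj _ _ (by omega) (by omega) h
    omega
  have hadjL : G.Adj (f k) (f (k - 1)) := by
    have := hsucc (k - 1) (by omega)
    rw [show k - 1 + 1 = k by omega] at this
    exact this.symm
  obtain ⟨P, w₂, hPT, hw₂, hs₂, he1, he2⟩ := exists_hole hT (x := f k) (p := f (k - 1))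
    (q := f (k + 1))
    (by
      rintro ((⟨i, ⟨h1, h2⟩, h3⟩ | h) | ⟨i, ⟨h1, h2⟩, h3⟩)
      · have := hinj _ _ (by omega) (by omega) h3
        omega
      · exact hvS ⟨v, rfl, f k, h, Or.inl hfk.symm⟩
      · have := hinj _ _ (by omega) (by omega) h3
        omega)
    (Or.inl (Or.inl ⟨k - 1, ⟨by omega, le_rfl⟩, rfl⟩))
    (Or.inr ⟨k + 1, ⟨le_rfl, by omega⟩, rfl⟩)
    hne
    (by
      intro h
      have := hch _ _ (by omega) (by omega) h
      omega)
    hadjL (hsucc k hk)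
    (by
      rintro t ((⟨i, ⟨h1, h2⟩, rfl⟩ | h) | ⟨i, ⟨h1, h2⟩, rfl⟩) hadj
      · have := hch _ _ (by omega) (by omega) hadj
        left
        rw [show i = k - 1 by omega]
      · exact absurd ⟨v, rfl, t, h, Or.inr (hfk ▸ hadj)⟩ hvS
      · have := hch _ _ (by omega) (by omega) hadj
        right
        rw [show i = k + 1 by omega])
  have hu₂ : u ∉ w₂.support := by
    rw [hs₂]
    rintro (h | h)
    · exact huv (hfk.symm.trans h.symm)
    · rcases hPT u h with (⟨i, ⟨h1, h2⟩, h3⟩ | h) | ⟨i, ⟨h1, h2⟩, h3⟩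
      · have := hinj i 0 (by omega) (by omega) (h3.trans hf0.symm)
        omega
      · exact huS h
      · have := hinj i 0 (by omega) (by omega) (h3.trans hf0.symm)
        omega
  have he3 : s(f (k - 1), f k) ∈ w.edges := by
    have := hed (k - 1) (by omega)
    rwa [show k - 1 + 1 = k by omega] at this
  exact hNC _ _ w w₂ hw hw₂ hu hu₂ ⟨f (k - 1), f k, f (k + 1), hne, he3, hed k hk, he1, he2⟩

theorem localChordalize_adj_left {G : SimpleGraph V} {u v : V} :
    (localChordalize G u).Adj u v ↔ G.Adj u v ∨ (v ≠ u ∧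
      ∃ (a : V) (w : G.Walk a a), IsHole G w ∧ u ∈ w.support ∧ v ∈ w.support) := by
  unfold localChordalize
  rw [SimpleGraph.sup_adj, SimpleGraph.fromRel_adj]
  constructor
  · rintro (h | ⟨h, ⟨-, h'⟩ | ⟨h', -⟩⟩)
    · exact Or.inl h
    · exact Or.inr ⟨h.symm, h'⟩
    · exact absurd h'.symm h
  · rintro (h | ⟨h, h'⟩)
    · exact Or.inl h
    · exact Or.inr ⟨h.symm, Or.inl ⟨rfl, h'⟩⟩

theorem localChordalize_adj_of_ne {G : SimpleGraph V} {u x y : V} (hx : x ≠ u) (hy : y ≠ u)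
    (h : (localChordalize G u).Adj x y) : G.Adj x y := by
  unfold localChordalize at h
  rw [SimpleGraph.sup_adj, SimpleGraph.fromRel_adj] at h
  rcases h with h | ⟨_, ⟨h, _⟩ | ⟨h, _⟩⟩
  · exact h
  · exact absurd h hx
  · exact absurd h hy

theorem walk_stays {G : SimpleGraph V} {A B : Set V} (hAB : ¬ Touch G A B) {a b : V}
    (p : G.Walk a b) : a ∈ A → (∀ z ∈ p.support, z ∈ A ∨ z ∈ B) → b ∈ A := by
  induction p with
  | nil => exact fun h _ => h
  | cons h p ih =>
    intro ha hz
    refine ih ?_ (fun z hz' => hz z (by simp [hz']))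
    rcases hz _ (List.mem_cons_of_mem _ p.start_mem_support) with h' | h'
    · exact h'
    · exact absurd ⟨_, ha, _, h', Or.inr h⟩ hAB

theorem no_hole_through {G : SimpleGraph V} {u : V} (hNC : VertexNC G u) {a : V}
    (w : (localChordalize G u).Walk a a) (hw : IsHole (localChordalize G u) w)
    (hu : u ∈ w.support) : False := by
  obtain ⟨n, f, hn, hf0, hfn, hinj, hsucc, hch, -, -, -⟩ := hole_index _ w hw hu
  have hfu : ∀ i, 1 ≤ i → i < n → f i ≠ u := by
    intro i h1 h2 h3
    have := hinj i 0 (by omega) (by omega) (h3.trans hf0.symm)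
    omega
  have hadj1 : (localChordalize G u).Adj u (f 1) := by
    have := hsucc 0 (by omega)
    rwa [hf0] at this
  have hadjk : (localChordalize G u).Adj u (f (n - 1)) := by
    have := hsucc (n - 1) (by omega)
    rw [show n - 1 + 1 = n by omega, hfn] at this
    exact this.symm
  have hle : ∀ x y, G.Adj x y → (localChordalize G u).Adj x y := fun x y h => Or.inl h
  have hnt : ¬ Touch G {f (n - 1)} {f 1} := by
    rintro ⟨_, rfl, _, rfl, h | h⟩
    · have := hinj _ _ (by omega) (by omega) h
      omega
    · have := hch _ _ (by omega) (by omega) (hle _ _ h)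
      omega
  obtain ⟨B, hB, hB1⟩ := exists_arm hNC (hfu (n - 1) (by omega) (by omega))
    ((localChordalize_adj_left.1 hadjk).imp id And.right) (SetConn.singleton G (f 1))
    (fun h => hfu 1 le_rfl (by omega) h.symm) hnt
  obtain ⟨hkB, huB, hcB, b, hbB, hub, hbun⟩ := hB
  obtain ⟨A, hA, hAB⟩ := exists_arm hNC (hfu 1 le_rfl (by omega))
    ((localChordalize_adj_left.1 hadj1).imp id And.right) hcB huB (fun h => hB1 h.symm')
  obtain ⟨h1A, huA, hcA, a', haA, hua, haun⟩ := hA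
  have hGs : ∀ i, 1 ≤ i → i + 1 < n → G.Adj (f i) (f (i + 1)) := fun i h1 h2 =>
    localChordalize_adj_of_ne (hfu i h1 (by omega)) (hfu (i + 1) (by omega) h2)
      (hsucc i (by omega))
  have hcQ : SetConn G (f '' Set.Icc 2 (n - 2)) :=
    SetConn.interval G f 2 (n - 2) (fun k h1 h2 => hGs k (by omega) (by omega))
  have hQ : ∀ y ∈ f '' Set.Icc 2 (n - 2), y ≠ u ∧ ¬ (localChordalize G u).Adj u y := by
    rintro _ ⟨i, ⟨h1, h2⟩, rfl⟩
    refine ⟨hfu i (by omega) (by omega), fun h => ?_⟩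
    rw [← hf0] at h
    have := hch 0 i (by omega) (by omega) (by rwa [hf0] at h ⊢)
    omega
  have hAQ : SetConn G (A ∪ f '' Set.Icc 2 (n - 2)) :=
    hcA.union hcQ ⟨f 1, h1A, f 2, ⟨2, ⟨le_rfl, by omega⟩, rfl⟩,
      Or.inr (hGs 1 le_rfl (by omega))⟩
  have hT : SetConn G ((A ∪ f '' Set.Icc 2 (n - 2)) ∪ B) := by
    refine hAQ.union hcB ⟨f (n - 2), Or.inr ⟨n - 2, ⟨by omega, le_rfl⟩, rfl⟩, f (n - 1), hkB,
      Or.inr ?_⟩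
    have := hGs (n - 2) (by omega) (by omega)
    rwa [show n - 2 + 1 = n - 1 by omega] at this
  obtain ⟨P, w₁, hPT, hw₁, hs₁, -, -⟩ := exists_hole hT (x := u) (p := a') (q := b)
    (by
      rintro ((h | h) | h)
      · exact huA h
      · exact (hQ u h).1 rfl
      · exact huB h)
    (Or.inl (Or.inl haA)) (Or.inr hbB)
    (fun h => hAB ⟨a', haA, b, hbB, Or.inl h⟩)
    (fun h => hAB ⟨a', haA, b, hbB, Or.inr h⟩)
    hua hub
    (by
      rintro t ((h | h) | h) hut
      · exact Or.inl (haun t h hut)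
      · exact absurd (hle _ _ hut) (hQ t h).2
      · exact Or.inr (hbun t h hut))
  have hPQ : ∀ z ∈ P.support, z ∈ A ∨ z ∈ B := by
    intro z hz
    rcases hPT z hz with (h | h) | h
    · exact Or.inl h
    · exfalso
      refine (hQ z h).2 (localChordalize_adj_left.2 (Or.inr ⟨(hQ z h).1, u, w₁, hw₁, ?_, ?_⟩))
      · exact (hs₁ u).2 (Or.inl rfl)
      · exact (hs₁ z).2 (Or.inr hz)
    · exact Or.inr h
  have := walk_stays hAB P haA hPQ
  exact hAB ⟨b, this, b, hbB, Or.inl rfl⟩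

/-- if `u` satisfies the NC property in `G`, then locally chordalizing
by `u` all holes of `G` through `u` creates no new hole: every hole of the resulting
graph is already a hole of `G`. -/
theorem stmt4 {V : Type*} [Fintype V] [DecidableEq V] (G : SimpleGraph V)
    (u : V) (hNC : VertexNC G u) :
    ∀ (a : V) (w : (localChordalize G u).Walk a a), IsHole (localChordalize G u) w →
      ∃ hE : (∀ e ∈ w.edges, e ∈ G.edgeSet), IsHole G (w.transfer G hE) := by
  intro a w hw
  have hu : u ∉ w.support := fun hu => no_hole_through hNC w hw hu
  have hE : ∀ e ∈ w.edges, e ∈ G.edgeSet := by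
    intro e he
    induction e with
    | _ x y =>
      have h1 := w.fst_mem_support_of_mem_edges he
      have h2 := w.snd_mem_support_of_mem_edges he
      have hx : x ≠ u := fun h => hu (h ▸ h1)
      have hy : y ≠ u := fun h => hu (h ▸ h2)
      exact localChordalize_adj_of_ne hx hy (w.adj_of_mem_edges he)
  refine ⟨hE, hw.1.transfer hE, by simpa using hw.2.1, ?_⟩
  intro x y hx hy hxy
  rw [Walk.support_transfer] at hx hy
  rw [Walk.edges_transfer]
  exact hw.2.2 x y hx hy (Or.inl hxy)
end

section
/- Let G be a finite simple graph with a hole cover C = {u_1, …, u_k} satisfying the NC property. Set G_0 = G and, for i = 1, …, k, let G_i be the graph obtained from G_{i−1} by locally chordalizing by u_i all holes of G_{i−1} containing u_i. Then G_k is chordal, and moreover the final graph G_k does not depend on the order in which the vertices u_1, …, u_k are processed. -/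
open SimpleGraph

variable {V : Type*}

/-- Any two vertices of `T` are joined by a walk inside `T`. -/
def WConn (G : SimpleGraph V) (T : Set V) : Prop :=
  ∀ x ∈ T, ∀ y ∈ T, ∃ p : G.Walk x y, ∀ z ∈ p.support, z ∈ T

theorem WConn.single (G : SimpleGraph V) (v : V) : WConn G {v} := by
  rintro x rfl y rfl
  exact ⟨Walk.nil, by simp⟩

theorem WConn.union {G : SimpleGraph V} {S T : Set V} (hS : WConn G S) (hT : WConn G T)
    {s t : V} (hs : s ∈ S) (ht : t ∈ T) (hst : s = t ∨ G.Adj s t) : WConn G (S ∪ T) := by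
  have key : ∀ x ∈ S, ∀ y ∈ T, ∃ p : G.Walk x y, ∀ z ∈ p.support, z ∈ S ∪ T := by
    intro x hx y hy
    obtain ⟨p, hp⟩ := hS x hx s hs
    obtain ⟨q, hq⟩ := hT t ht y hy
    rcases hst with rfl | hst
    · refine ⟨p.append q, fun z hz => ?_⟩
      rcases (Walk.mem_support_append_iff _ _).1 hz with h | h
      · exact Or.inl (hp z h)
      · exact Or.inr (hq z h)
    · refine ⟨p.append (Walk.cons hst q), fun z hz => ?_⟩
      rcases (Walk.mem_support_append_iff _ _).1 hz with h | h
      · exact Or.inl (hp z h)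
      · rw [Walk.support_cons, List.mem_cons] at h
        rcases h with rfl | h
        · exact Or.inl hs
        · exact Or.inr (hq z h)
  rintro x (hx | hx) y (hy | hy)
  · obtain ⟨p, hp⟩ := hS x hx y hy
    exact ⟨p, fun z hz => Or.inl (hp z hz)⟩
  · exact key x hx y hy
  · obtain ⟨p, hp⟩ := key y hy x hx
    exact ⟨p.reverse, fun z hz => hp z (by simpa using hz)⟩
  · obtain ⟨p, hp⟩ := hT x hx y hy
    exact ⟨p, fun z hz => Or.inr (hp z hz)⟩

theorem WConn.support {G : SimpleGraph V} {x y : V} (p : G.Walk x y) :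
    WConn G {z | z ∈ p.support} := by
  classical
  have key : ∀ a ∈ p.support, ∃ q : G.Walk x a, ∀ z ∈ q.support, z ∈ p.support :=
    fun a ha => ⟨p.takeUntil a ha, fun z hz => p.support_takeUntil_subset_support ha hz⟩
  intro a ha b hb
  obtain ⟨q, hq⟩ := key a ha
  obtain ⟨r, hr⟩ := key b hb
  refine ⟨q.reverse.append r, fun z hz => ?_⟩
  rcases (Walk.mem_support_append_iff _ _).1 hz with h | h
  · exact hq z (by simpa using h)
  · exact hr z h

/-- In a connected set there is an induced path between any two vertices. -/
theorem WConn.induced_path {G : SimpleGraph V} {T : Set V} (hT : WConn G T) {a b : V}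
    (ha : a ∈ T) (hb : b ∈ T) :
    ∃ p : G.Walk a b, p.IsPath ∧ (∀ z ∈ p.support, z ∈ T) ∧
      ∀ x y, x ∈ p.support → y ∈ p.support → G.Adj x y → s(x, y) ∈ p.edges := by
  classical
  have hex : ∃ n, ∃ p : G.Walk a b, (∀ z ∈ p.support, z ∈ T) ∧ p.length = n := by
    obtain ⟨p, hp⟩ := hT a ha b hb
    exact ⟨_, p, hp, rfl⟩
  obtain ⟨p, hp, hl⟩ := Nat.find_spec hex
  have hmin : ∀ q : G.Walk a b, (∀ z ∈ q.support, z ∈ T) → p.length ≤ q.length := by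
    intro q hq
    rw [hl]
    exact Nat.find_min' hex ⟨q, hq, rfl⟩
  have hpath : p.IsPath := by
    have := p.bypass_eq_self_of_length_le_length_bypass
      (hmin p.bypass fun z hz => hp z (p.support_bypass_subset_support hz))
    rw [← this]
    exact p.bypass_isPath
  have key : ∀ (x y : V) (p₁ : G.Walk a x) (p₂ : G.Walk x y) (p₃ : G.Walk y b),
      p = p₁.append (p₂.append p₃) → G.Adj x y → s(x, y) ∈ p.edges := by
    intro x y p₁ p₂ p₃ h hxy
    have h1 := hmin (p₁.append (Walk.cons hxy p₃)) (by
      intro z hz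
      apply hp
      rw [h]
      simp only [Walk.mem_support_append_iff, Walk.support_cons, List.mem_cons] at hz ⊢
      rcases hz with hz | rfl | hz
      · exact Or.inl hz
      · exact Or.inl (Walk.end_mem_support _)
      · exact Or.inr (Or.inr hz))
    rw [h] at h1
    simp only [Walk.length_append, Walk.length_cons] at h1
    have : s(x, y) ∈ p₂.edges := by
      cases p₂ with
      | nil => exact absurd hxy (G.loopless.irrefl _)
      | cons h' q =>
        cases q with
        | nil => simp
        | cons h'' q => simp at h1; omega
    rw [h]
    simp [this]
  refine ⟨p, hpath, hp, ?_⟩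
  intro x y hx hy hxy
  have hy' : y ∈ (p.takeUntil x hx).support ∨ y ∈ (p.dropUntil x hx).support := by
    rw [← Walk.mem_support_append_iff, p.take_spec hx]; exact hy
  rcases hy' with h | h
  · rw [Sym2.eq_swap]
    refine key y x ((p.takeUntil x hx).takeUntil y h) ((p.takeUntil x hx).dropUntil y h)
      (p.dropUntil x hx) ?_ hxy.symm
    rw [Walk.append_assoc, Walk.take_spec, Walk.take_spec]
  · refine key x y (p.takeUntil x hx) ((p.dropUntil x hx).takeUntil y h)
      ((p.dropUntil x hx).dropUntil y h) ?_ hxy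
    rw [Walk.take_spec, Walk.take_spec]

/-- Building a hole through `c` from a connected set containing exactly two, nonadjacent,
neighbours of `c`. -/
theorem hole_construct {G : SimpleGraph V} {T : Set V} (hT : WConn G T) {a b c : V}
    (ha : a ∈ T) (hb : b ∈ T) (hc : c ∉ T) (hab : a ≠ b) (hnab : ¬ G.Adj a b)
    (hca : G.Adj c a) (hcb : G.Adj c b) (hN : ∀ y ∈ T, G.Adj c y → y = a ∨ y = b) :
    ∃ (p : G.Walk a b) (w : G.Walk c c), IsHole G w ∧ (∀ z ∈ p.support, z ∈ T) ∧
      (∀ z, z ∈ w.support ↔ z = c ∨ z ∈ p.support) ∧ s(c, a) ∈ w.edges ∧ s(c, b) ∈ w.edges := by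
  obtain ⟨p, hp, hpT, hind⟩ := hT.induced_path ha hb
  have hcp : c ∉ p.support := fun h => hc (hpT c h)
  have hsupp : ∀ z, z ∈ (Walk.cons hca (p.concat hcb.symm)).support ↔ z = c ∨ z ∈ p.support := by
    intro z
    simp only [Walk.support_cons, Walk.support_concat, List.mem_cons, List.mem_append,
      List.not_mem_nil, or_false]
    tauto
  have hedge : ∀ e, e ∈ (Walk.cons hca (p.concat hcb.symm)).edges ↔
      e = s(c, a) ∨ e ∈ p.edges ∨ e = s(b, c) := by
    intro e
    simp only [Walk.edges_cons, Walk.edges_concat, List.mem_cons, List.concat_eq_append,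
      List.mem_append]
    simp
  refine ⟨p, Walk.cons hca (p.concat hcb.symm), ⟨?_, ?_, ?_⟩, hpT, hsupp, ?_, ?_⟩
  · rw [Walk.cons_isCycle_iff, Walk.concat_isPath_iff]
    refine ⟨⟨hp, hcp⟩, ?_⟩
    intro h
    simp only [Walk.edges_concat, List.concat_eq_append, List.mem_append, List.mem_singleton] at h
    rcases h with h | h
    · exact hcp (p.fst_mem_support_of_mem_edges h)
    · rw [Sym2.eq_iff] at h
      rcases h with ⟨rfl, _⟩ | ⟨_, rfl⟩
      · exact hc hb
      · exact hab rfl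
  · simp only [Walk.length_cons, Walk.length_concat]
    cases p with
    | nil => exact absurd rfl hab
    | cons h q =>
      cases q with
      | nil => exact absurd h hnab
      | cons h' q => simp
  · have key : ∀ y, y ∈ p.support → G.Adj c y →
        s(c, y) ∈ (Walk.cons hca (p.concat hcb.symm)).edges := by
      intro y hy h
      rw [hedge]
      rcases hN y (hpT y hy) h with rfl | rfl
      · exact Or.inl rfl
      · exact Or.inr (Or.inr Sym2.eq_swap)
    intro x y hx hy hxy
    rw [hsupp] at hx hy
    rcases hx with rfl | hx
    · rcases hy with rfl | hy
      · exact absurd hxy (G.loopless.irrefl _)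
      · exact key y hy hxy
    · rcases hy with rfl | hy
      · rw [Sym2.eq_swap]; exact key x hx hxy.symm
      · rw [hedge]; exact Or.inr (Or.inl (hind x y hx hy hxy))
  · rw [hedge]; exact Or.inl rfl
  · rw [hedge]; exact Or.inr (Or.inr Sym2.eq_swap)

theorem IsHole.rot [DecidableEq V] {G : SimpleGraph V} {a u : V} {w : G.Walk a a}
    (hw : IsHole G w) (hu : u ∈ w.support) : IsHole G (w.rotate u hu) := by
  refine ⟨hw.1.rotate hu, by simpa using hw.2.1, ?_⟩
  intro x y hx hy hxy
  rw [(w.rotate_edges u hu).mem_iff]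
  rw [Walk.mem_support_rotate_iff] at hx hy
  exact hw.2.2 x y hx hy hxy

theorem IsHole.rev {G : SimpleGraph V} {a : V} {w : G.Walk a a}
    (hw : IsHole G w) : IsHole G w.reverse := by
  refine ⟨hw.1.reverse, by simpa using hw.2.1, ?_⟩
  intro x y hx hy hxy
  simp only [Walk.support_reverse, List.mem_reverse, Walk.edges_reverse] at hx hy ⊢
  exact hw.2.2 x y hx hy hxy

/-- One side of a hole through nonadjacent `u` and `v`. -/
theorem one_side {G : SimpleGraph V} {u v : V} (p : G.Walk u v) (p' : G.Walk v u)
    (hw : IsHole G (p.append p')) (huv : u ≠ v) (hnuv : ¬ G.Adj u v) :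
    ∃ (A : Set V) (x a : V), WConn G A ∧ x ∈ A ∧ a ∈ A ∧ u ∉ A ∧ v ∉ A ∧
      (∀ z ∈ A, z ∈ p.support) ∧ (∀ z ∈ A, z ∉ p'.support) ∧
      G.Adj u x ∧ G.Adj v a ∧ (∀ y ∈ A, G.Adj u y → y = x) ∧ (∀ y ∈ A, G.Adj v y → y = a) ∧
      s(v, a) ∈ (p.append p').edges := by
  cases p with
  | nil => exact absurd rfl huv
  | @cons _ x _ hux r =>
    cases r with
    | nil => exact absurd hux hnuv
    | cons h2 r2 =>
      obtain ⟨a, q, hav, hq⟩ := Walk.exists_cons_eq_concat h2 r2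
      rw [hq] at hw ⊢
      have hnd : ((q.concat hav).support ++ p'.support.tail).Nodup := by
        have := hw.1.support_nodup
        rw [Walk.support_append, Walk.support_cons] at this
        simpa using this
      have hp'u : u ∈ p'.support.tail := by
        cases p' with
        | nil => exact absurd rfl huv
        | cons h r => simp
      rw [Walk.support_concat] at hnd
      have hd : ∀ z ∈ q.support, z ≠ v ∧ z ∉ p'.support.tail := by
        intro z hz
        rw [List.nodup_append, List.nodup_append] at hnd
        constructor
        · exact hnd.1.2.2 z hz v (by simp)
        · intro h
          exact hnd.2.2 z (by simp [hz]) z h rfl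
      have hdu : u ∉ q.support := fun h => (hd u h).2 hp'u
      have hdv : v ∉ q.support := fun h => (hd v h).1 rfl
      have hdp : ∀ z ∈ q.support, z ∉ p'.support := by
        intro z hz h
        rw [← Walk.cons_tail_support] at h
        rcases List.mem_cons.1 h with h | h
        · exact (hd z hz).1 h
        · exact (hd z hz).2 h
      have hsup : ∀ z ∈ q.support, z ∈ ((Walk.cons hux (q.concat hav)).append p').support := by
        intro z hz
        rw [Walk.mem_support_append_iff]
        left
        rw [Walk.support_cons, Walk.support_concat]
        simp [hz]
      have hedge : ∀ y ∈ q.support, ∀ t, s(t, y) ∈ ((Walk.cons hux (q.concat hav)).append p').edges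
          → s(t, y) = s(u, x) ∨ s(t, y) ∈ q.edges ∨ s(t, y) = s(a, v) := by
        intro y hy t h
        simp only [Walk.edges_append, Walk.edges_cons, Walk.edges_concat, List.concat_eq_append,
          List.mem_append, List.mem_cons, List.not_mem_nil, or_false] at h
        rcases h with h | h
        · tauto
        · exact absurd (p'.snd_mem_support_of_mem_edges h) (hdp y hy)
      refine ⟨{z | z ∈ q.support}, x, a, WConn.support q, q.start_mem_support,
        q.end_mem_support, hdu, hdv, ?_, hdp, hux, hav.symm, ?_, ?_, ?_⟩
      · intro z hz
        rw [Walk.support_cons, Walk.support_concat]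
        have : z ∈ q.support := hz
        simp [this]
      · intro y hy huy
        rcases hedge y hy u (hw.2.2 u y (by simp) (hsup y hy) huy) with h | h | h
        · rw [Sym2.eq_iff] at h
          rcases h with ⟨_, h⟩ | ⟨_, h⟩
          · exact h
          · exact absurd (h ▸ hy) hdu
        · exact absurd (q.fst_mem_support_of_mem_edges h) hdu
        · rw [Sym2.eq_iff] at h
          rcases h with ⟨h, _⟩ | ⟨h, _⟩
          · exact absurd (h ▸ q.end_mem_support) hdu
          · exact absurd h huv
      · intro y hy hvy
        rcases hedge y hy v (hw.2.2 v y (by simp) (hsup y hy) hvy) with h | h | h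
        · rw [Sym2.eq_iff] at h
          rcases h with ⟨h, _⟩ | ⟨h, _⟩
          · exact absurd h.symm huv
          · exact absurd (h ▸ q.start_mem_support) hdv
        · exact absurd (q.fst_mem_support_of_mem_edges h) hdv
        · rw [Sym2.eq_iff] at h
          rcases h with ⟨_, h⟩ | ⟨_, h⟩
          · exact absurd (h ▸ hy) hdv
          · exact h
      · rw [Sym2.eq_swap]
        simp

/-- The side lemma: some side of a hole through `u`, `v` does not touch a given connected set. -/
theorem side_lemma {G : SimpleGraph V} {u v c : V} (hNC : VertexNC G u) (w : G.Walk c c)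
    (hw : IsHole G w) (hu : u ∈ w.support) (hv : v ∈ w.support) (huv : u ≠ v)
    (hnuv : ¬ G.Adj u v) (S : Set V) (hS : WConn G S) (huS : u ∉ S) (hvS : v ∉ S)
    (hnS : ∀ y ∈ S, ¬ G.Adj v y) :
    ∃ (A : Set V) (x a : V), WConn G A ∧ x ∈ A ∧ a ∈ A ∧ u ∉ A ∧ v ∉ A ∧
      G.Adj u x ∧ G.Adj v a ∧ (∀ y ∈ A, G.Adj u y → y = x) ∧
      (∀ s ∈ S, ∀ t ∈ A, s ≠ t ∧ ¬ G.Adj s t) := by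
  classical
  have hw0 := hw.rot hu
  have hv0 : v ∈ (w.rotate u hu).support := by rwa [Walk.mem_support_rotate_iff]
  generalize w.rotate u hu = w0 at hw0 hv0
  set p := w0.takeUntil v hv0 with hp
  set p' := w0.dropUntil v hv0 with hp'
  have hsp : p.append p' = w0 := w0.take_spec hv0
  clear_value p p'
  subst hsp
  have hrev : IsHole G (p'.reverse.append p.reverse) := by
    rw [← Walk.reverse_append]; exact hw0.rev
  obtain ⟨A, x, a, hA, hxA, haA, huA, hvA, hAp, hAp', hux, hva, hAu, hAv, hAe⟩ :=
    one_side p p' hw0 huv hnuv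
  obtain ⟨B, x', b, hB, hxB, hbB, huB, hvB, hBp', hBp, hux', hvb, hBu, hBv, hBe⟩ :=
    one_side p'.reverse p.reverse hrev huv hnuv
  simp only [Walk.support_reverse, List.mem_reverse] at hBp hBp'
  rw [← Walk.reverse_append, Walk.edges_reverse, List.mem_reverse] at hBe
  by_cases h1 : ∀ s ∈ S, ∀ t ∈ A, s ≠ t ∧ ¬ G.Adj s t
  · exact ⟨A, x, a, hA, hxA, haA, huA, hvA, hux, hva, hAu, h1⟩
  by_cases h2 : ∀ s ∈ S, ∀ t ∈ B, s ≠ t ∧ ¬ G.Adj s t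
  · exact ⟨B, x', b, hB, hxB, hbB, huB, hvB, hux', hvb, hBu, h2⟩
  exfalso
  push Not at h1 h2
  obtain ⟨s, hs, t, ht, hst⟩ := h1
  obtain ⟨s', hs', t', ht', hst'⟩ := h2
  have hSA : WConn G (S ∪ A) := hS.union hA hs ht (by tauto)
  have hSAB : WConn G ((S ∪ A) ∪ B) := hSA.union hB (Or.inl hs') ht' (by tauto)
  have hab : a ≠ b := fun h => hBp b hbB (hAp b (h ▸ haA))
  have hnab : ¬ G.Adj a b := by
    intro h
    have := hw0.2.2 a b ((Walk.mem_support_append_iff _ _).2 (Or.inl (hAp a haA)))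
      ((Walk.mem_support_append_iff _ _).2 (Or.inr (hBp' b hbB))) h
    rw [Walk.edges_append, List.mem_append] at this
    rcases this with h | h
    · exact hBp b hbB (p.snd_mem_support_of_mem_edges h)
    · exact hAp' a haA (p'.fst_mem_support_of_mem_edges h)
  obtain ⟨q, w', hw', hqT, hsup, he1, he2⟩ := hole_construct hSAB (a := a) (b := b) (c := v)
    (Or.inl (Or.inr haA)) (Or.inr hbB) (by simp [hvS, hvA, hvB]) hab hnab hva hvb (by
      rintro y ((hy | hy) | hy) h
      · exact absurd h (hnS y hy)
      · exact Or.inl (hAv y hy h)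
      · exact Or.inr (hBv y hy h))
  refine hNC _ _ _ w' hw0 hw' (by simp) ?_ ⟨a, v, b, hab, ?_, hBe, ?_, he2⟩
  · rw [hsup]
    rintro (h | h)
    · exact huv h
    · have := hqT u h
      simp [huS, huA, huB] at this
  · rw [Sym2.eq_swap]; exact hAe
  · rw [Sym2.eq_swap]; exact he1

theorem adj_lc {G : SimpleGraph V} {u x y : V} : (localChordalize G u).Adj x y ↔
    G.Adj x y ∨ (x ≠ y ∧
      ((x = u ∧ ∃ (a : V) (w : G.Walk a a), IsHole G w ∧ u ∈ w.support ∧ y ∈ w.support) ∨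
      (y = u ∧ ∃ (a : V) (w : G.Walk a a), IsHole G w ∧ u ∈ w.support ∧ x ∈ w.support))) := by
  simp [localChordalize]

theorem adj_lc_ne {G : SimpleGraph V} {u x y : V} (hx : x ≠ u) (hy : y ≠ u) :
    (localChordalize G u).Adj x y ↔ G.Adj x y := by
  rw [adj_lc]; simp [hx, hy]

theorem adj_lc_u {G : SimpleGraph V} {u y : V} : (localChordalize G u).Adj u y ↔
    G.Adj u y ∨ (u ≠ y ∧
      ∃ (a : V) (w : G.Walk a a), IsHole G w ∧ u ∈ w.support ∧ y ∈ w.support) := by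
  rw [adj_lc]
  constructor
  · rintro (h | ⟨h, h' | h'⟩)
    · exact Or.inl h
    · exact Or.inr ⟨h, h'.2⟩
    · exact absurd h'.1.symm h
  · rintro (h | ⟨h, hole⟩)
    · exact Or.inl h
    · exact Or.inr ⟨h, Or.inl ⟨rfl, hole⟩⟩

/-- Core of the argument. -/
theorem lc_core {G : SimpleGraph V} {u v₁ v₂ v₃ vm : V} {P : Set V} (hNC : VertexNC G u)
    (hP : WConn G P) (huP : u ∉ P) (hvm : vm ∈ P) (hv₃ : v₃ ∈ P) (h12 : G.Adj v₁ v₂)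
    (h23 : G.Adj v₂ v₃) (h1P : v₁ ∉ P) (hn1P : ∀ y ∈ P, ¬ G.Adj v₁ y)
    (h1u : v₁ ≠ u) (h2u : v₂ ≠ u) (hn2 : ¬ (localChordalize G u).Adj u v₂)
    (h1 : (localChordalize G u).Adj u v₁) (hn1 : ¬ G.Adj u v₁)
    (hm : (localChordalize G u).Adj u vm)
    (hPu : ∀ y ∈ P, (localChordalize G u).Adj u y → y = vm) : False := by
  have hPu' : ∀ y ∈ P, G.Adj u y → y = vm := fun y hy h => hPu y hy (adj_lc_u.2 (Or.inl h))
  obtain ⟨S, s, hS, hPS, hsS, huS, h1S, hn1S, hus, hSu⟩ : ∃ (S : Set V) (s : V), WConn G S ∧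
      (∀ y ∈ P, y ∈ S) ∧ s ∈ S ∧ u ∉ S ∧ v₁ ∉ S ∧ (∀ y ∈ S, ¬ G.Adj v₁ y) ∧ G.Adj u s ∧
      (∀ y ∈ S, G.Adj u y → y = s) := by
    by_cases hum : G.Adj u vm
    · exact ⟨P, vm, hP, fun y hy => hy, hvm, huP, h1P, hn1P, hum, hPu'⟩
    · obtain ⟨hne, a, w, hw, huw, hmw⟩ := (adj_lc_u.1 hm).resolve_left hum
      obtain ⟨A, x, b, hA, hxA, hbA, huA, hvA, hux, hvb, hAu, hno⟩ :=
        side_lemma hNC w hw huw hmw hne hum {v₁} (WConn.single G v₁)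
          (by simpa using h1u.symm) (by rintro rfl; exact h1P hvm)
          (by rintro y rfl h; exact hn1P vm hvm h.symm)
      refine ⟨P ∪ A, x, hP.union hA hvm hbA (Or.inr hvb), fun y hy => Or.inl hy, Or.inr hxA,
        by simp [huP, huA], ?_, ?_, hux, ?_⟩
      · rintro (h | h)
        · exact h1P h
        · exact (hno v₁ rfl v₁ h).1 rfl
      · rintro y (h | h)
        · exact hn1P y h
        · exact (hno v₁ rfl y h).2
      · rintro y (h | h) h'
        · exact absurd (hPu' y h h' ▸ h') hum
        · exact hAu y h h'
  obtain ⟨_, a, w, hw, huw, h1w⟩ := (adj_lc_u.1 h1).resolve_left hn1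
  obtain ⟨A, x, b, hA, hxA, hbA, huA, h1A, hux, h1b, hAu, hno⟩ :=
    side_lemma hNC w hw huw h1w h1u.symm hn1 S hS huS h1S hn1S
  have hT : WConn G ((A ∪ {v₁}) ∪ ({v₂} ∪ S)) :=
    (hA.union (WConn.single G v₁) hbA rfl (Or.inr h1b.symm)).union
      ((WConn.single G v₂).union hS rfl (hPS v₃ hv₃) (Or.inr h23))
      (Or.inr rfl) (Or.inl rfl) (Or.inr h12)
  have hnu2 : ¬ G.Adj u v₂ := fun h => hn2 (adj_lc_u.2 (Or.inl h))
  obtain ⟨p, w', hw', hpT, hsup, -, -⟩ := hole_construct hT (a := x) (b := s) (c := u)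
    (Or.inl (Or.inl hxA)) (Or.inr (Or.inr hsS))
    (by
      rintro ((h | h) | h | h)
      · exact huA h
      · exact h1u h.symm
      · exact h2u h.symm
      · exact huS h)
    (hno s hsS x hxA).1.symm (fun h => (hno s hsS x hxA).2 h.symm) hux hus
    (by
      rintro y ((h | h) | h | h) h'
      · exact Or.inl (hAu y h h')
      · exact absurd (h ▸ h') hn1
      · exact absurd (h ▸ h') hnu2
      · exact Or.inr (hSu y h h'))
  have h2p : v₂ ∈ p.support := by
    by_contra hcon
    obtain ⟨d, hd, hd1, hd2⟩ := p.exists_boundary_dart (A ∪ {v₁}) (Or.inl hxA) (by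
      rintro (h | h)
      · exact (hno s hsS s h).1 rfl
      · exact h1S (h ▸ hsS))
    have hsnd : d.snd ∈ p.support := p.dart_snd_mem_support_of_mem_darts hd
    rcases hpT _ hsnd with h | h | h
    · exact hd2 h
    · exact hcon (h ▸ hsnd)
    · rcases hd1 with h' | h'
      · exact (hno _ h _ h').2 d.adj.symm
      · exact hn1S _ h (h' ▸ d.adj)
  exact hn2 (adj_lc_u.2 (Or.inr ⟨h2u.symm, _, w', hw', by simp, by rw [hsup]; exact Or.inr h2p⟩))

theorem IsHole.congr {G H : SimpleGraph V} {a : V} {w : G.Walk a a} (hw : IsHole G w)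
    (h : ∀ e ∈ w.edges, e ∈ H.edgeSet)
    (h' : ∀ x y, x ∈ w.support → y ∈ w.support → H.Adj x y → G.Adj x y) :
    IsHole H (w.transfer H h) := by
  refine ⟨hw.1.transfer h, by simpa using hw.2.1, ?_⟩
  intro x y hx hy hxy
  rw [Walk.support_transfer] at hx hy
  rw [Walk.edges_transfer]
  exact hw.2.2 x y hx hy (h' x y hx hy hxy)

theorem lc_half {G : SimpleGraph V} {u : V} (hNC : VertexNC G u)
    (w : (localChordalize G u).Walk u u) (hw : IsHole (localChordalize G u) w)
    (hsnd : ¬ G.Adj u w.snd) : False := by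
  obtain ⟨hcyc, hlen, hind⟩ := hw
  cases w with
  | nil => simp at hlen
  | @cons _ v₁ _ h1 w1 =>
    cases w1 with
    | nil => simp at hlen
    | @cons _ v₂ _ h12 w2 =>
      cases w2 with
      | nil => simp at hlen
      | @cons _ v₃ _ h23 w3 =>
        cases w3 with
        | nil => simp at hlen
        | cons h34 w4 =>
          obtain ⟨vm, r, hmu, hr⟩ := Walk.exists_cons_eq_concat h34 w4
          rw [hr] at hcyc hind
          simp only [Walk.snd_cons] at hsnd
          rw [Walk.cons_isCycle_iff] at hcyc
          obtain ⟨hpath, hnot⟩ := hcyc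
          rw [Walk.cons_isPath_iff, Walk.cons_isPath_iff, Walk.concat_isPath_iff] at hpath
          simp only [Walk.support_cons, Walk.support_concat, List.mem_cons, List.mem_append,
            List.not_mem_nil, or_false, not_or] at hpath
          obtain ⟨⟨⟨hrp, hur⟩, h2r, h2u⟩, h12n, h1r, h1u⟩ := hpath
          simp only [Walk.support_cons, Walk.support_concat, List.mem_cons, List.mem_append,
            List.not_mem_nil, or_false, Walk.edges_cons, Walk.edges_concat,
            List.concat_eq_append] at hind
          have hre : ∀ e ∈ r.edges, e ∈ G.edgeSet := by
            intro e he
            induction e with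
            | _ x y =>
              have hx := r.fst_mem_support_of_mem_edges he
              have hy := r.snd_mem_support_of_mem_edges he
              have := r.adj_of_mem_edges he
              rw [adj_lc_ne (u := u) (x := x) (y := y) (fun h => hur (h ▸ hx)) (fun h => hur (h ▸ hy))] at this
              exact this
          have h3r : v₃ ∈ r.support := r.start_mem_support
          have hmr : vm ∈ r.support := r.end_mem_support
          have h3u : v₃ ≠ u := fun h => hur (h ▸ h3r)
          have hP : WConn G {z | z ∈ r.support} := by
            have := WConn.support (r.transfer G hre)
            simpa using this
          refine lc_core (u := u) (v₁ := v₁) (v₂ := v₂) (v₃ := v₃) (vm := vm)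
            hNC hP hur hmr h3r ((adj_lc_ne h1u h2u).1 h12)
            ((adj_lc_ne h2u h3u).1 h23) h1r ?_ h1u h2u ?_ h1 hsnd hmu.symm ?_
          · intro y hy h
            have hyu : y ≠ u := fun h => hur (h ▸ hy)
            have hy' : y ∈ r.support := hy
            have h' := hind v₁ y (by simp) (by simp [hy']) ((adj_lc_ne h1u hyu).2 h)
            rcases h' with h' | h' | h' | h' | h'
            · rw [Sym2.eq_iff] at h'
              rcases h' with ⟨h', _⟩ | ⟨_, h'⟩
              · exact h1u h'
              · exact hyu h'
            · rw [Sym2.eq_iff] at h'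
              rcases h' with ⟨_, h'⟩ | ⟨h', _⟩
              · exact h2r (h' ▸ hy')
              · exact h12n h'
            · rw [Sym2.eq_iff] at h'
              rcases h' with ⟨h', _⟩ | ⟨h', _⟩
              · exact h12n h'
              · exact h1r (h' ▸ h3r)
            · exact h1r (r.fst_mem_support_of_mem_edges h')
            · rw [Sym2.eq_iff] at h'
              rcases h' with ⟨h', _⟩ | ⟨h', _⟩
              · exact h1r (h' ▸ hmr)
              · exact h1u h'
          · intro h
            have h' := hind u v₂ (by simp) (by simp) h
            rcases h' with h' | h' | h' | h' | h'
            · rw [Sym2.eq_iff] at h'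
              rcases h' with ⟨_, h'⟩ | ⟨_, h'⟩
              · exact h12n h'.symm
              · exact h2u h'
            · rw [Sym2.eq_iff] at h'
              rcases h' with ⟨h', _⟩ | ⟨h', _⟩
              · exact h1u h'.symm
              · exact h2u h'.symm
            · rw [Sym2.eq_iff] at h'
              rcases h' with ⟨h', _⟩ | ⟨h', _⟩
              · exact h2u h'.symm
              · exact h3u h'.symm
            · exact hur (r.fst_mem_support_of_mem_edges h')
            · rw [Sym2.eq_iff] at h'
              rcases h' with ⟨_, h'⟩ | ⟨_, h'⟩
              · exact h2u h'
              · exact h2r (h' ▸ hmr)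
          · intro y hy h
            have hyu : y ≠ u := fun h => hur (h ▸ hy)
            have hy' : y ∈ r.support := hy
            have h' := hind u y (by simp) (by simp [hy']) h
            rcases h' with h' | h' | h' | h' | h'
            · rw [Sym2.eq_iff] at h'
              rcases h' with ⟨_, h'⟩ | ⟨_, h'⟩
              · exact absurd (h' ▸ hy') h1r
              · exact absurd h' hyu
            · rw [Sym2.eq_iff] at h'
              rcases h' with ⟨h', _⟩ | ⟨h', _⟩
              · exact absurd h'.symm h1u
              · exact absurd h'.symm h2u
            · rw [Sym2.eq_iff] at h'
              rcases h' with ⟨h', _⟩ | ⟨h', _⟩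
              · exact absurd h'.symm h2u
              · exact absurd h'.symm h3u
            · exact absurd (r.fst_mem_support_of_mem_edges h') hur
            · rw [Sym2.eq_iff] at h'
              rcases h' with ⟨_, heq⟩ | ⟨_, heq⟩
              · exact absurd heq hyu
              · exact heq

/-- After locally chordalizing by `u`, no hole contains `u`. -/
theorem lc_no_hole {G : SimpleGraph V} {u a : V} (hNC : VertexNC G u)
    (w : (localChordalize G u).Walk a a) (hw : IsHole (localChordalize G u) w) :
    u ∉ w.support := by
  classical
  intro hu
  have hw0 := hw.rot hu
  generalize w.rotate u hu = w0 at hw0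
  by_cases h1 : G.Adj u w0.snd
  swap
  · exact lc_half hNC w0 hw0 h1
  by_cases h2 : G.Adj u w0.penultimate
  swap
  · refine lc_half hNC w0.reverse hw0.rev ?_
    rwa [Walk.snd_reverse]
  have hle : ∀ x y, G.Adj x y → (localChordalize G u).Adj x y := fun x y h => adj_lc.2 (Or.inl h)
  have hnb : ∀ y, s(u, y) ∈ w0.edges → y = w0.snd ∨ y = w0.penultimate := by
    intro y hy
    have hcyc := hw0.1
    have hlen := hw0.2.1
    clear hw0 h1 h2
    cases w0 with
    | nil => simp at hlen
    | @cons _ x _ h p =>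
      rw [Walk.cons_isCycle_iff] at hcyc
      cases p with
      | nil => simp at hlen
      | cons h' r =>
        obtain ⟨b, q, hb, hq⟩ := Walk.exists_cons_eq_concat h' r
        rw [hq] at hcyc hy ⊢
        rw [Walk.concat_isPath_iff] at hcyc
        simp only [Walk.edges_cons, Walk.edges_concat, List.concat_eq_append, List.mem_cons,
          List.mem_append, List.not_mem_nil, or_false] at hy
        have hpen : (Walk.cons h (q.concat hb)).penultimate = b := by
          rw [← Walk.concat_cons, Walk.penultimate_concat]
        rw [hpen, Walk.snd_cons]
        rcases hy with hy | hy | hy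
        · rw [Sym2.eq_iff] at hy
          rcases hy with ⟨_, hy⟩ | ⟨hy, hy'⟩
          · exact Or.inl hy
          · exact absurd hy h.ne
        · exact absurd (q.fst_mem_support_of_mem_edges hy) hcyc.1.2
        · rw [Sym2.eq_iff] at hy
          rcases hy with ⟨hy, hy'⟩ | ⟨_, hy⟩
          · exact absurd hy hb.symm.ne
          · exact Or.inr hy
  have hedges : ∀ e ∈ w0.edges, e ∈ G.edgeSet := by
    intro e he
    induction e with
    | _ x y =>
      rw [SimpleGraph.mem_edgeSet]
      by_cases hx : x = u
      · subst hx
        rcases hnb y he with rfl | rfl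
        · exact h1
        · exact h2
      · by_cases hy : y = u
        · subst hy
          rw [Sym2.eq_swap] at he
          rcases hnb x he with rfl | rfl
          · exact h1.symm
          · exact h2.symm
        · exact (adj_lc_ne hx hy).1 (w0.adj_of_mem_edges he)
  have hG := hw0.congr hedges (fun x y _ _ h => hle x y h)
  have hall : ∀ y ∈ w0.support, y ≠ u → y = w0.snd ∨ y = w0.penultimate := by
    intro y hy hyu
    apply hnb
    apply hw0.2.2 u y (by simp) hy
    refine adj_lc_u.2 (Or.inr ⟨hyu.symm, _, _, hG, by simp, by simpa using hy⟩)
  have hnd := hw0.1.support_nodup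
  have hlen := hw0.2.1
  have hsub : w0.support.tail.toFinset ⊆ {u, w0.snd, w0.penultimate} := by
    intro y hy
    have hy : y ∈ w0.support := List.mem_of_mem_tail (by simpa using hy)
    by_cases h : y = u
    · simp [h]
    · rcases hall y hy h with h | h <;> simp [h]
  have hc := Finset.card_le_card hsub
  rw [List.toFinset_card_of_nodup hnd] at hc
  have h3 := Finset.card_le_three (a := u) (b := w0.snd) (c := w0.penultimate)
  simp only [List.length_tail, Walk.length_support] at hc
  omega

/-- `E` and `S` are the edge set and vertex set of a hole of `G`. -/
def HoleES (G : SimpleGraph V) (E : Set (Sym2 V)) (S : Set V) : Prop :=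
  ∃ (a : V) (w : G.Walk a a), IsHole G w ∧ E = {e | e ∈ w.edges} ∧ S = {z | z ∈ w.support}

theorem holeES_lc {G : SimpleGraph V} {u : V} (hNC : VertexNC G u) (E : Set (Sym2 V))
    (S : Set V) : HoleES (localChordalize G u) E S ↔ HoleES G E S ∧ u ∉ S := by
  constructor
  · rintro ⟨a, w, hw, rfl, rfl⟩
    have hu := lc_no_hole hNC w hw
    refine ⟨⟨a, _, hw.congr (H := G) ?_ ?_, by rw [Walk.edges_transfer], by rw [Walk.support_transfer]⟩, hu⟩
    · intro e he
      induction e with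
      | _ x y =>
        have hx := w.fst_mem_support_of_mem_edges he
        have hy := w.snd_mem_support_of_mem_edges he
        exact (adj_lc_ne (u := u) (x := x) (y := y) (fun h => hu (h ▸ hx)) (fun h => hu (h ▸ hy))).1 (w.adj_of_mem_edges he)
    · exact fun x y _ _ h => adj_lc.2 (Or.inl h)
  · rintro ⟨⟨a, w, hw, rfl, rfl⟩, hu⟩
    refine ⟨a, _, hw.congr (H := localChordalize G u) ?_ ?_,
      by rw [Walk.edges_transfer], by rw [Walk.support_transfer]⟩
    · intro e he
      induction e with
      | _ x y => exact adj_lc.2 (Or.inl (w.adj_of_mem_edges he))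
    · intro x y hx hy h
      exact (adj_lc_ne (u := u) (x := x) (y := y) (fun h => hu (h ▸ hx)) (fun h => hu (h ▸ hy))).1 h

theorem vertexNC_iff {G : SimpleGraph V} {u : V} : VertexNC G u ↔
    ∀ E₁ S₁ E₂ S₂, HoleES G E₁ S₁ → HoleES G E₂ S₂ → u ∈ S₁ → u ∉ S₂ →
      ¬ ∃ x y z : V, x ≠ z ∧ s(x, y) ∈ E₁ ∧ s(y, z) ∈ E₁ ∧ s(x, y) ∈ E₂ ∧ s(y, z) ∈ E₂ := by
  constructor
  · rintro h _ _ _ _ ⟨a, w, hw, rfl, rfl⟩ ⟨b, w', hw', rfl, rfl⟩ hu hu'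
    exact h a b w w' hw hw' hu hu'
  · intro h a b w w' hw hw' hu hu'
    exact h _ _ _ _ ⟨a, w, hw, rfl, rfl⟩ ⟨b, w', hw', rfl, rfl⟩ hu hu'

theorem adj_lc' {G : SimpleGraph V} {u x y : V} : (localChordalize G u).Adj x y ↔
    G.Adj x y ∨ (x ≠ y ∧ ∃ E S, HoleES G E S ∧ u ∈ S ∧ x ∈ S ∧ y ∈ S ∧ (x = u ∨ y = u)) := by
  rw [adj_lc]
  constructor
  · rintro (h | ⟨h, ⟨rfl, a, w, hw, hx, hy⟩ | ⟨rfl, a, w, hw, hy, hx⟩⟩)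
    · exact Or.inl h
    · exact Or.inr ⟨h, _, _, ⟨a, w, hw, rfl, rfl⟩, hx, hx, hy, Or.inl rfl⟩
    · exact Or.inr ⟨h, _, _, ⟨a, w, hw, rfl, rfl⟩, hy, hx, hy, Or.inr rfl⟩
  · rintro (h | ⟨h, _, _, ⟨a, w, hw, rfl, rfl⟩, hu, hx, hy, rfl | rfl⟩)
    · exact Or.inl h
    · exact Or.inr ⟨h, Or.inl ⟨rfl, a, w, hw, hu, hy⟩⟩
    · exact Or.inr ⟨h, Or.inr ⟨rfl, a, w, hw, hu, hx⟩⟩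

theorem chordalizeList_spec (l : List V) : ∀ (G : SimpleGraph V), l.Nodup →
    (∀ u ∈ l, VertexNC G u) →
    (∀ E S, HoleES G E S → ∀ u ∈ l, ∀ v ∈ l, u ∈ S → v ∈ S → u = v) →
    (∀ E S, HoleES (chordalizeList G l) E S ↔ HoleES G E S ∧ ∀ u ∈ l, u ∉ S) ∧
    (∀ x y, (chordalizeList G l).Adj x y ↔ G.Adj x y ∨
      (x ≠ y ∧ ∃ E S, HoleES G E S ∧ x ∈ S ∧ y ∈ S ∧ (x ∈ l ∨ y ∈ l))) := by
  induction l with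
  | nil => intro G _ _ _; simp [chordalizeList]
  | cons u l ih =>
    intro G hnd hNC hone
    have hu : VertexNC G u := hNC u (by simp)
    have hlc := holeES_lc hu
    rw [List.nodup_cons] at hnd
    obtain ⟨ih1, ih2⟩ := ih (localChordalize G u) hnd.2
      (by
        intro v hv
        have := vertexNC_iff.1 (hNC v (by simp [hv]))
        rw [vertexNC_iff]
        intro E₁ S₁ E₂ S₂ h1 h2
        exact this E₁ S₁ E₂ S₂ ((hlc _ _).1 h1).1 ((hlc _ _).1 h2).1)
      (by
        intro E S h v hv v' hv'
        exact hone E S ((hlc _ _).1 h).1 v (by simp [hv]) v' (by simp [hv']))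
    refine ⟨?_, ?_⟩
    · intro E S
      rw [chordalizeList, ih1, hlc]
      simp [and_assoc]
    · intro x y
      rw [chordalizeList, ih2, adj_lc']
      constructor
      · rintro ((h | ⟨h, E, S, hE, _, hx, hy, hor⟩) | ⟨h, E, S, hE, hx, hy, hor⟩)
        · exact Or.inl h
        · exact Or.inr ⟨h, E, S, hE, hx, hy, by rcases hor with rfl | rfl <;> simp⟩
        · exact Or.inr ⟨h, E, S, ((hlc _ _).1 hE).1, hx, hy, by
            rcases hor with h | h <;> simp [h]⟩
      · rintro (h | ⟨h, E, S, hE, hx, hy, hor⟩)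
        · exact Or.inl (Or.inl h)
        · by_cases huS : u ∈ S
          · left; right
            refine ⟨h, E, S, hE, huS, hx, hy, ?_⟩
            rcases hor with h' | h'
            · exact Or.inl (hone E S hE x h' u (by simp) hx huS)
            · exact Or.inr (hone E S hE y h' u (by simp) hy huS)
          · right
            refine ⟨h, E, S, (hlc _ _).2 ⟨hE, huS⟩, hx, hy, ?_⟩
            rcases hor with h' | h'
            · exact Or.inl ((List.mem_cons.1 h').resolve_left (fun e => huS (e ▸ hx)))
            · exact Or.inr ((List.mem_cons.1 h').resolve_left (fun e => huS (e ▸ hy)))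

/-- if `C` is a hole cover of `G` satisfying the NC property, then
successively locally chordalizing by the vertices of `C` (in any order) yields a
chordal graph, and the result does not depend on the order. -/
theorem stmt5 {V : Type*} [Fintype V] [DecidableEq V] (G : SimpleGraph V) (C : Set V)
    (hcov : IsHoleCover G C) (hNC : SetNC G C) :
    ∀ l : List V, l.Nodup → {v | v ∈ l} = C →
      IsChordal (chordalizeList G l) ∧
        ∀ l' : List V, l'.Nodup → {v | v ∈ l'} = C →
          chordalizeList G l = chordalizeList G l' := by
  have spec : ∀ l : List V, l.Nodup → {v | v ∈ l} = C → _ :=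
    fun l hnd hl => chordalizeList_spec l G hnd
      (fun u hu => hNC.1 u (hl ▸ hu))
      (by
        rintro _ _ ⟨a, w, hw, rfl, rfl⟩ u hu v hv
        exact hNC.2 a w hw u (hl ▸ hu) v (hl ▸ hv))
  intro l hnd hl
  refine ⟨?_, ?_⟩
  · intro a w hw
    obtain ⟨⟨b, w', hw', -, hS⟩, hno⟩ := ((spec l hnd hl).1 _ _).1 ⟨a, w, hw, rfl, rfl⟩
    obtain ⟨u, huC, hu⟩ := hcov.2 b w' hw'
    rw [← hl] at huC
    refine hno u huC ?_
    rw [hS]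
    exact hu
  · intro l' hnd' hl'
    have hmem : ∀ z, z ∈ l ↔ z ∈ l' := fun z => Set.ext_iff.1 (hl.trans hl'.symm) z
    ext x y
    rw [(spec l hnd hl).2, (spec l' hnd' hl').2, hmem x, hmem y]
end

section
/- Let k be a positive integer and let G be a finite simple graph that is the union of k pairwise edge-disjoint copies of the complete graph K_k. Then ω(G) = k. Furthermore, if G has a maximal clique of size k that is not one of these k copies of K_k, then G is chordal. -/
open SimpleGraph

variable {V : Type*}

/-- `G` is the union of `k` pairwise edge-disjoint copies of `K_k`, given by the
cliques `𝒦 0, …, 𝒦 (k-1)`. -/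
def IsEdgeDisjointUnionOfKk {V : Type*} (G : SimpleGraph V) (k : ℕ)
    (𝒦 : Fin k → Finset V) : Prop :=
  (∀ i, G.IsNClique k (𝒦 i)) ∧
  (∀ i j : Fin k, i ≠ j → ∀ x y : V, x ∈ 𝒦 i → y ∈ 𝒦 i → x ∈ 𝒦 j → y ∈ 𝒦 j → x = y) ∧
  (∀ v : V, ∃ i, v ∈ 𝒦 i) ∧
  (∀ x y : V, G.Adj x y → ∃ i, x ∈ 𝒦 i ∧ y ∈ 𝒦 i)

/-- De Bruijn–Erdős for a clique not contained in any of the copies. -/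
theorem clique_deBruijnErdos {V : Type*} [DecidableEq V] (G : SimpleGraph V)
    (k : ℕ) (𝒦 : Fin k → Finset V) (hU : IsEdgeDisjointUnionOfKk G k 𝒦)
    (L : Finset V) (hL : G.IsClique ↑L) (hn : ∀ i, ¬ L ⊆ 𝒦 i) :
    L.card ≤ k ∧ (L.card = k → ∀ i j : Fin k, i ≠ j → ∃ p ∈ L, p ∈ 𝒦 i ∧ p ∈ 𝒦 j) := by
  obtain ⟨-, hlin, hcov, hadj⟩ := hU
  have hline : ∀ {p q : L}, p ≠ q → ∃ i, p.1 ∈ 𝒦 i ∧ q.1 ∈ 𝒦 i := by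
    intro p q hpq
    exact hadj _ _ (hL p.2 q.2 (fun h => hpq (Subtype.ext h)))
  have hline2 : ∀ p q : L, p ≠ q → ∃ i, p.1 ∈ 𝒦 i ∧ q.1 ∈ 𝒦 i := fun _ _ h => hline h
  choose mk hmk using hline2
  letI : Membership L (Fin k) := ⟨fun i p => p.1 ∈ 𝒦 i⟩
  have hpt : ∀ i : Fin k, ∃ p : L, p.1 ∉ 𝒦 i := by
    intro i
    obtain ⟨x, hx, hxi⟩ := Finset.not_subset.mp (hn i)
    exact ⟨⟨x, hx⟩, hxi⟩
  letI : Configuration.HasLines L (Fin k) :=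
    { exists_point := hpt
      exists_line := by
        intro p
        change ∃ l : Fin k, p.1 ∉ 𝒦 l
        by_contra hcon
        push Not at hcon
        obtain ⟨i₀, h0⟩ := hcov p.1
        obtain ⟨q, hq⟩ := hpt i₀
        have hpq : p ≠ q := by rintro rfl; exact hq h0
        obtain ⟨i, hpi, hqi⟩ := hline hpq
        obtain ⟨r, hr⟩ := hpt i
        have hqr : q ≠ r := by rintro rfl; exact hr hqi
        obtain ⟨j, hqj, hrj⟩ := hline hqr
        have hij : i ≠ j := by rintro rfl; exact hr hrj
        exact hpq (Subtype.ext (hlin i j hij _ _ hpi hqi (hcon j) hqj))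
      eq_or_eq := by
        intro p q i j h1 h2 h3 h4
        by_cases hij : i = j
        · exact Or.inr hij
        · exact Or.inl (Subtype.ext (hlin i j hij _ _ h1 h2 h3 h4))
      mkLine := fun {p q} h => mk p q h
      mkLine_ax := fun {p q} h => hmk p q h }
  refine ⟨by simpa using Configuration.HasLines.card_le L (Fin k), ?_⟩
  intro hc i j hij
  letI : Configuration.HasPoints L (Fin k) := Configuration.HasLines.hasPoints (by simpa using hc)
  have := Configuration.HasPoints.mkPoint_ax (P := L) hij
  exact ⟨_, (Configuration.HasPoints.mkPoint (P := L) hij).2, this.1, this.2⟩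

/-- Each vertex of a hole has two nonadjacent distinct neighbours on the hole. -/
theorem hole_nbrs {V : Type*} [DecidableEq V] (G : SimpleGraph V) {a : V} (w : G.Walk a a)
    (hw : IsHole G w) (v : V) (hv : v ∈ w.support) :
    ∃ x ∈ w.support, ∃ y ∈ w.support, G.Adj v x ∧ G.Adj v y ∧ x ≠ y ∧ ¬ G.Adj x y := by
  obtain ⟨hc, h4, hind⟩ := hw
  have hc' : (w.rotate v hv).IsCycle := hc.rotate hv
  have h4' : 4 ≤ (w.rotate v hv).length := by simpa using h4
  have hs : ∀ n, (w.rotate v hv).getVert n ∈ w.support := fun n =>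
    (w.mem_support_rotate_iff v hv).1 (Walk.getVert_mem_support _ n)
  have hind' : ∀ x y : V, x ∈ w.support → y ∈ w.support → G.Adj x y →
      s(x, y) ∈ (w.rotate v hv).edges := fun x y hx hy h =>
    (w.rotate_edges v hv).mem_iff.2 (hind x y hx hy h)
  generalize w.rotate v hv = c at *
  have inj : ∀ i j, 1 ≤ i → i ≤ c.length → 1 ≤ j → j ≤ c.length →
      c.getVert i = c.getVert j → i = j := fun i j h1 h2 h3 h4 h =>
    hc'.getVert_injOn ⟨h1, h2⟩ ⟨h3, h4⟩ h
  have h0 : c.getVert 0 = c.getVert c.length := by simp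
  refine ⟨c.getVert 1, hs _, c.getVert (c.length - 1), hs _, ?_, ?_, ?_, ?_⟩
  · have := c.adj_getVert_succ (i := 0) (by omega)
    simpa using this
  · have := c.adj_getVert_succ (i := c.length - 1) (by omega)
    rw [Nat.sub_add_cancel (by omega), Walk.getVert_length] at this
    exact this.symm
  · intro h
    have := inj _ _ (by omega) (by omega) (by omega) (by omega) h
    omega
  · intro h
    obtain ⟨i, hi, he⟩ := (Walk.mk_mem_edges_iff_exists c).1 (hind' _ _ (hs _) (hs _) h)
    have key : ∀ i j, i ≤ c.length → 1 ≤ j → j < c.length →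
        c.getVert i = c.getVert j → i = j := by
      intro i j hi h1 hj hij
      rcases Nat.eq_zero_or_pos i with rfl | hpos
      · rw [h0] at hij
        have := inj _ _ (by omega) (by omega) (by omega) (by omega) hij
        omega
      · exact inj _ _ (by omega) (by omega) (by omega) (by omega) hij
    rcases Sym2.eq_iff.1 he with ⟨e1, e2⟩ | ⟨e1, e2⟩
    · have := key _ _ (by omega) (by omega) (by omega) e1
      have := key _ _ (by omega) (by omega) (by omega) e2
      omega
    · have := key _ _ (by omega) (by omega) (by omega) e1
      have := key _ _ (by omega) (by omega) (by omega) e2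
      omega

/-- if `G` is the union of `k` edge-disjoint copies of `K_k`, then
`ω(G) = k`; furthermore, if `G` has a maximal clique of size `k` that is not one
of these copies, then `G` is chordal. -/
theorem stmt12 {V : Type*} [Fintype V] [DecidableEq V] (G : SimpleGraph V)
    (k : ℕ) (hk : 0 < k) (𝒦 : Fin k → Finset V)
    (hU : IsEdgeDisjointUnionOfKk G k 𝒦) :
    G.cliqueNum = k ∧
      ∀ L : Finset V, G.IsClique ↑L →
        (∀ L' : Finset V, G.IsClique ↑L' → L ⊆ L' → L' = L) →
        L.card = k → (∀ i, L ≠ 𝒦 i) → IsChordal G := by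
  have hU' := hU
  obtain ⟨hcl, hlin, hcov, hadj⟩ := hU
  refine ⟨le_antisymm ?_ ?_, ?_⟩
  · obtain ⟨s, hs⟩ := G.exists_isNClique_cliqueNum
    rw [← hs.card_eq]
    by_cases h : ∃ i, s ⊆ 𝒦 i
    · obtain ⟨i, hi⟩ := h
      exact (Finset.card_le_card hi).trans (hcl i).card_eq.le
    · push Not at h
      exact (clique_deBruijnErdos G k 𝒦 hU' s hs.isClique h).1
  · have h := hcl ⟨0, hk⟩
    have := h.isClique.card_le_cliqueNum
    rwa [h.card_eq] at this
  · intro L hL _ hLk hne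
    have hn : ∀ i, ¬ L ⊆ 𝒦 i := fun i hi =>
      hne i (Finset.eq_of_subset_of_card_le hi (by rw [(hcl i).card_eq, hLk]))
    have hmeet := (clique_deBruijnErdos G k 𝒦 hU' L hL hn).2 hLk
    intro a w hw
    have hall : ∀ v ∈ w.support, v ∈ L := by
      intro v hv
      by_contra hvL
      obtain ⟨x, -, y, -, hvx, hvy, hxy, hnadj⟩ := hole_nbrs G w hw v hv
      obtain ⟨i, hvi, hxi⟩ := hadj _ _ hvx
      obtain ⟨j, hvj, hyj⟩ := hadj _ _ hvy
      by_cases hij : i = j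
      · subst hij
        exact hnadj ((hcl i).isClique hxi hyj hxy)
      · obtain ⟨p, hpL, hpi, hpj⟩ := hmeet i j hij
        exact hvL (hlin i j hij _ _ hvi hpi hvj hpj ▸ hpL)
    obtain ⟨x, hx, y, hy, -, -, hxy, hnadj⟩ := hole_nbrs G w hw a w.start_mem_support
    exact hnadj (hL (hall x hx) (hall y hy) hxy)
end
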